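/- arXiv:1209.3690 — 6 statements merged into one kernel-verified Lean document; each statement's English description precedes it below -/
import Mathlib

section
/- Let β be a non-increasing weight sequence, let U and Y be complex Hilbert spaces, and let S : 𝔻 → L(U,Y) be analytic. Then S is a contractive multiplier from H²(U) to H²_β(Y) if and only if there exists a function 𝐒 in the Schur class S(U, ℓ²(Y)) such that S(z) = Ψ_β(z) 𝐒(z) for all z ∈ 𝔻. -/
open Metric Filter

noncomputable section

/-- `β` is a weight sequence: positive, `β 0 = 1`, and `liminf β_j^(1/j) ≥ 1`. -/
def IsWeightSeq (β : ℕ → ℝ) : Prop :=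
  (∀ j, 0 < β j) ∧ β 0 = 1 ∧
    1 ≤ Filter.liminf (fun j : ℕ => β j ^ ((1 : ℝ) / j)) Filter.atTop

/-- `S`, with Taylor coefficients `Sc`, is a contractive multiplier from `H²(U)` to
`H²_β(Y)`: for every square-summable input sequence `h`, the Cauchy-product output
coefficients `g ℓ = Σ_{j≤ℓ} Sc j (h (ℓ-j))` satisfy `Σ β_ℓ ‖g ℓ‖² ≤ Σ ‖h k‖²`. -/
def IsContractiveMultiplier {U Y : Type*} [NormedAddCommGroup U] [InnerProductSpace ℂ U]
    [NormedAddCommGroup Y] [InnerProductSpace ℂ Y]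
    (β : ℕ → ℝ) (Sc : ℕ → (U →L[ℂ] Y)) : Prop :=
  ∀ h : ℕ → U, Summable (fun k => ‖h k‖ ^ 2) →
    Summable (fun ℓ => β ℓ * ‖∑ j ∈ Finset.range (ℓ + 1), Sc j (h (ℓ - j))‖ ^ 2) ∧
    ∑' ℓ, β ℓ * ‖∑ j ∈ Finset.range (ℓ + 1), Sc j (h (ℓ - j))‖ ^ 2 ≤ ∑' k, ‖h k‖ ^ 2

/-- The Schur class: analytic on the unit disk with contractive values. -/
def IsSchur {U V : Type*} [NormedAddCommGroup U] [NormedSpace ℂ U]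
    [NormedAddCommGroup V] [NormedSpace ℂ V] (F : ℂ → (U →L[ℂ] V)) : Prop :=
  AnalyticOn ℂ F (ball 0 1) ∧ ∀ z ∈ ball (0 : ℂ) 1, ‖F z‖ ≤ 1

open scoped InnerProductSpace

lemma exists_contraction_comp_eq {H K₁ K₂ : Type*}
    [NormedAddCommGroup H] [InnerProductSpace ℂ H]
    [NormedAddCommGroup K₁] [InnerProductSpace ℂ K₁] [CompleteSpace K₁]
    [NormedAddCommGroup K₂] [InnerProductSpace ℂ K₂] [CompleteSpace K₂]
    (J : H →L[ℂ] K₁) (L : H →L[ℂ] K₂) (h : ∀ x, ‖L x‖ ≤ ‖J x‖) :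
    ∃ V : K₁ →L[ℂ] K₂, ‖V‖ ≤ 1 ∧ ∀ x, V (J x) = L x := by
  set R : Submodule ℂ K₁ := (LinearMap.range (J : H →ₗ[ℂ] K₁)).topologicalClosure with hR
  have hmem : ∀ x, J x ∈ R := fun x => Submodule.le_topologicalClosure _ ⟨x, rfl⟩
  let e : H →ₗ[ℂ] R := (J : H →ₗ[ℂ] K₁).codRestrict R hmem
  have hd : DenseRange e := by
    intro y
    have hy : (y : K₁) ∈ closure (LinearMap.range (J : H →ₗ[ℂ] K₁) : Set K₁) := y.2
    rw [closure_subtype]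
    convert hy using 2
    ext z
    constructor
    · rintro ⟨_, ⟨x, rfl⟩, rfl⟩
      exact ⟨x, rfl⟩
    · rintro ⟨x, rfl⟩
      exact ⟨e x, ⟨x, rfl⟩, rfl⟩
  have hn : ∀ x, ‖(L : H →ₗ[ℂ] K₂) x‖ ≤ 1 * ‖e x‖ := fun x => by
    rw [one_mul]; exact h x
  have : CompleteSpace R := (Submodule.isClosed_topologicalClosure _).completeSpace_coe
  refine ⟨((L : H →ₗ[ℂ] K₂).extendOfNorm e).comp R.orthogonalProjectionOnto, ?_, fun x => ?_⟩
  · refine ContinuousLinearMap.opNorm_le_bound _ zero_le_one fun y => ?_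
    refine (LinearMap.norm_extendOfNorm_apply_le hd 1 hn _).trans ?_
    gcongr
    exact R.norm_orthogonalProjectionOnto_apply_le y
  · have hx : R.orthogonalProjectionOnto (J x) = e x :=
      Submodule.orthogonalProjectionOnto_mem_subspace_eq_self (e x)
    rw [ContinuousLinearMap.comp_apply, hx, LinearMap.extendOfNorm_eq hd ⟨1, hn⟩]
    rfl

lemma exists_defect {H G : Type*}
    [NormedAddCommGroup H] [InnerProductSpace ℂ H] [CompleteSpace H]
    [NormedAddCommGroup G] [InnerProductSpace ℂ G] [CompleteSpace G]
    (N : H →L[ℂ] G) (hN : ‖N‖ ≤ 1) :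
    ∃ Q : H →L[ℂ] H, ∀ x, ‖Q x‖ ^ 2 + ‖N x‖ ^ 2 = ‖x‖ ^ 2 := by
  set D : H →L[ℂ] H := 1 - N.adjoint.comp N with hD
  have key : ∀ x, (⟪D x, x⟫_ℂ) = ((‖x‖ ^ 2 - ‖N x‖ ^ 2 : ℝ) : ℂ) := fun x => by
    simp [hD, ContinuousLinearMap.adjoint_inner_left, inner_self_eq_norm_sq_to_K]
  have hpos : 0 ≤ D := by
    rw [ContinuousLinearMap.nonneg_iff_isPositive, ContinuousLinearMap.isPositive_iff_complex]
    intro x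
    rw [key]
    refine ⟨rfl, ?_⟩
    have : ‖N x‖ ≤ ‖x‖ := by
      simpa using N.le_of_opNorm_le hN x
    simp only [RCLike.re_to_complex, Complex.ofReal_re]
    nlinarith [norm_nonneg (N x)]
  refine ⟨CFC.sqrt D, fun x => ?_⟩
  have hs : (CFC.sqrt D).adjoint = CFC.sqrt D := (CFC.sqrt_nonneg D).star_eq
  have h2 : ((‖CFC.sqrt D x‖ ^ 2 : ℝ) : ℂ) = ⟪D x, x⟫_ℂ := by
    have h3 := congrArg (fun T : H →L[ℂ] H => ⟪T x, x⟫_ℂ) (CFC.sqrt_mul_sqrt_self D hpos)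
    rw [← h3]
    change _ = ⟪CFC.sqrt D (CFC.sqrt D x), x⟫_ℂ
    nth_rw 2 [← hs]
    rw [ContinuousLinearMap.adjoint_inner_left, inner_self_eq_norm_sq_to_K]
    simp
  rw [key] at h2
  have := Complex.ofReal_injective h2
  linarith

/-- The transfer function of a contractive colligation belongs to the Schur class. -/
lemma exists_schur_of_colligation {X U K : Type*}
    [NormedAddCommGroup X] [NormedSpace ℂ X] [CompleteSpace X]
    [NormedAddCommGroup U] [NormedSpace ℂ U]
    [NormedAddCommGroup K] [NormedSpace ℂ K] [CompleteSpace K]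
    (A : X →L[ℂ] X) (B : U →L[ℂ] X) (C : X →L[ℂ] K) (D : U →L[ℂ] K)
    (hWn : ∀ a b, ‖A a + B b‖ ^ 2 + ‖C a + D b‖ ^ 2 ≤ ‖a‖ ^ 2 + ‖b‖ ^ 2) :
    ∃ F : ℂ → (U →L[ℂ] K), IsSchur F ∧ ∀ z ∈ ball (0 : ℂ) 1, ∀ u, ∃ x,
      x = A (z • x) + B u ∧ F z u = C (z • x) + D u := by
  have hA : ‖A‖ ≤ 1 := by
    refine A.opNorm_le_bound zero_le_one fun a => ?_
    have := hWn a 0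
    simp only [map_zero, add_zero, norm_zero] at this
    rw [one_mul, ← sq_le_sq₀ (norm_nonneg _) (norm_nonneg _)]
    nlinarith [sq_nonneg ‖C a‖]
  have hu : ∀ z ∈ ball (0 : ℂ) 1, IsUnit (1 - z • A) := fun z hz => by
    apply isUnit_one_sub_of_norm_lt_one
    rw [norm_smul]
    have : ‖z‖ < 1 := by simpa using hz
    nlinarith [norm_nonneg z, norm_nonneg A]
  let F : ℂ → (U →L[ℂ] K) := fun z => D + z • C.comp ((Ring.inverse (1 - z • A)).comp B)
  have hF : ∀ z ∈ ball (0 : ℂ) 1, ∀ u, ∃ x, x = A (z • x) + B u ∧ F z u = C (z • x) + D u := by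
    intro z hz u
    refine ⟨Ring.inverse (1 - z • A) (B u), ?_, ?_⟩
    · have h1 := congrArg (fun R : X →L[ℂ] X => R (B u)) (Ring.mul_inverse_cancel _ (hu z hz))
      change Ring.inverse (1 - z • A) (B u) - z • A (Ring.inverse (1 - z • A) (B u)) = B u at h1
      rw [map_smul, ← sub_eq_iff_eq_add']
      exact h1
    · rw [map_smul, add_comm]
      rfl
  refine ⟨F, ⟨?_, ?_⟩, hF⟩
  · refine (DifferentiableOn.analyticOnNhd (fun z hz => ?_) isOpen_ball).analyticOn
    apply DifferentiableAt.differentiableWithinAt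
    have h1 : DifferentiableAt ℂ (fun z : ℂ => Ring.inverse (1 - z • A)) z := by
      have : DifferentiableAt ℂ (Ring.inverse : (X →L[ℂ] X) → _) (1 - z • A) :=
        differentiableAt_inverse (hu z hz)
      exact this.comp z (f := fun z : ℂ => 1 - z • A) (by fun_prop)
    fun_prop
  · intro z hz
    refine ContinuousLinearMap.opNorm_le_bound _ zero_le_one fun u => ?_
    obtain ⟨x, hx, hy⟩ := hF z hz u
    have := hWn (z • x) u
    rw [← hx, ← hy, norm_smul, mul_pow] at this
    have hz' : ‖z‖ < 1 := by simpa using hz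
    have hz2 : ‖z‖ ^ 2 ≤ 1 := pow_le_one₀ (norm_nonneg _) hz'.le
    rw [one_mul, ← sq_le_sq₀ (norm_nonneg _) (norm_nonneg _)]
    nlinarith [sq_nonneg ‖x‖]

/-- Lurking isometry: a contractive transfer function solving a Stein-type inequality. -/
lemma exists_schur_transfer {H U K X : Type*}
    [NormedAddCommGroup H] [InnerProductSpace ℂ H] [CompleteSpace H]
    [NormedAddCommGroup U] [InnerProductSpace ℂ U] [CompleteSpace U]
    [NormedAddCommGroup K] [InnerProductSpace ℂ K] [CompleteSpace K]
    [NormedAddCommGroup X] [InnerProductSpace ℂ X] [CompleteSpace X]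
    (T : H →L[ℂ] H) (P : K →L[ℂ] H) (M : U →L[ℂ] H) (Q : H →L[ℂ] X)
    (h : ∀ x, ‖Q x‖ ^ 2 + ‖M.adjoint x‖ ^ 2 ≤ ‖Q (T.adjoint x)‖ ^ 2 + ‖P.adjoint x‖ ^ 2) :
    ∃ F : ℂ → (U →L[ℂ] K), IsSchur F ∧ ∀ z ∈ ball (0 : ℂ) 1, ∀ u, ∃ x,
      T (Q.adjoint x) + P (F z u) = z • Q.adjoint x + M u := by
  let e₁ := (WithLp.prodContinuousLinearEquiv 2 ℂ X K).symm
  let e₂ := (WithLp.prodContinuousLinearEquiv 2 ℂ X U).symm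
  let J : H →L[ℂ] WithLp 2 (X × K) :=
    (e₁ : X × K →L[ℂ] WithLp 2 (X × K)).comp ((Q.comp T.adjoint).prod P.adjoint)
  let L : H →L[ℂ] WithLp 2 (X × U) :=
    (e₂ : X × U →L[ℂ] WithLp 2 (X × U)).comp (Q.prod M.adjoint)
  obtain ⟨V, hV, hVJ⟩ := exists_contraction_comp_eq J L fun x => by
    rw [← sq_le_sq₀ (norm_nonneg _) (norm_nonneg _), WithLp.prod_norm_sq_eq_of_L2,
      WithLp.prod_norm_sq_eq_of_L2]
    exact h x
  let W := V.adjoint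
  have hW : ∀ v, ‖W v‖ ≤ ‖v‖ := fun v => by
    have : ‖W‖ ≤ 1 := by simpa [W] using hV
    simpa using W.le_of_opNorm_le this v
  have hJ : ∀ (a : X) (b : K), J.adjoint (e₁ (a, b)) = T (Q.adjoint a) + P b := fun a b => by
    refine ext_inner_right ℂ fun y => ?_
    rw [ContinuousLinearMap.adjoint_inner_left, WithLp.prod_inner_apply, inner_add_left]
    congr 1
    · rw [← ContinuousLinearMap.adjoint_inner_right T, ContinuousLinearMap.adjoint_inner_left]
      rfl
    · rw [← ContinuousLinearMap.adjoint_inner_right P]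
      rfl
  have hL : ∀ (a : X) (b : U), L.adjoint (e₂ (a, b)) = Q.adjoint a + M b := fun a b => by
    refine ext_inner_right ℂ fun y => ?_
    rw [ContinuousLinearMap.adjoint_inner_left, WithLp.prod_inner_apply, inner_add_left]
    congr 1
    · rw [ContinuousLinearMap.adjoint_inner_left]
      rfl
    · rw [← ContinuousLinearMap.adjoint_inner_right M]
      rfl
  have hWL : ∀ v, J.adjoint (W v) = L.adjoint v := fun v => by
    refine ext_inner_right ℂ fun y => ?_
    rw [ContinuousLinearMap.adjoint_inner_left, ContinuousLinearMap.adjoint_inner_left,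
      ContinuousLinearMap.adjoint_inner_left, hVJ]
  let W' : X × U →L[ℂ] X × K :=
    (e₁.symm : WithLp 2 (X × K) →L[ℂ] X × K).comp
      (W.comp (e₂ : X × U →L[ℂ] WithLp 2 (X × U)))
  let A : X →L[ℂ] X := (ContinuousLinearMap.fst ℂ X K).comp (W'.comp (.inl ℂ X U))
  let B : U →L[ℂ] X := (ContinuousLinearMap.fst ℂ X K).comp (W'.comp (.inr ℂ X U))
  let C : X →L[ℂ] K := (ContinuousLinearMap.snd ℂ X K).comp (W'.comp (.inl ℂ X U))
  let D : U →L[ℂ] K := (ContinuousLinearMap.snd ℂ X K).comp (W'.comp (.inr ℂ X U))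
  have hW' : ∀ a b, W (e₂ (a, b)) = e₁ (A a + B b, C a + D b) := fun a b => by
    have h1 : W' (a, b) = (A a + B b, C a + D b) := by
      have : ((a, b) : X × U) = (a, 0) + (0, b) := by simp
      rw [this, map_add]
      rfl
    rw [← h1]
    simp [W']
  have hWn : ∀ a b, ‖A a + B b‖ ^ 2 + ‖C a + D b‖ ^ 2 ≤ ‖a‖ ^ 2 + ‖b‖ ^ 2 := fun a b => by
    have := hW (e₂ (a, b))
    rw [hW', ← sq_le_sq₀ (norm_nonneg _) (norm_nonneg _), WithLp.prod_norm_sq_eq_of_L2,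
      WithLp.prod_norm_sq_eq_of_L2] at this
    exact this
  obtain ⟨F, hFS, hF⟩ := exists_schur_of_colligation A B C D hWn
  refine ⟨F, hFS, ?_⟩
  · intro z hz u
    obtain ⟨x, hx, hy⟩ := hF z hz u
    refine ⟨x, ?_⟩
    have := hWL (e₂ (z • x, u))
    rw [hW', ← hx, ← hy, hJ, hL, map_smul] at this
    exact this

lemma lp_two_hasSum_norm_sq {E : Type*} [NormedAddCommGroup E] (f : lp (fun _ : ℕ => E) 2) :
    HasSum (fun j => ‖f j‖ ^ 2) (‖f‖ ^ 2) := by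
  simpa using lp.hasSum_norm (p := 2) (by norm_num) f

lemma memℓp_two_of_summable {E : Type*} [NormedAddCommGroup E] {f : ℕ → E}
    (hf : Summable fun j => ‖f j‖ ^ 2) : Memℓp f 2 := by
  rw [memℓp_gen_iff (by norm_num)]
  simpa using hf

lemma exists_lp_two_clm {V G : Type*} [NormedAddCommGroup V] [NormedSpace ℂ V]
    [NormedAddCommGroup G] [NormedSpace ℂ G] (a : ℕ → V →ₗ[ℂ] G)
    (ha : ∀ v, Summable (fun j => ‖a j v‖ ^ 2) ∧ ∑' j, ‖a j v‖ ^ 2 ≤ ‖v‖ ^ 2) :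
    ∃ T : V →L[ℂ] lp (fun _ : ℕ => G) 2, ‖T‖ ≤ 1 ∧ ∀ v j, T v j = a j v := by
  let T₀ : V →ₗ[ℂ] lp (fun _ : ℕ => G) 2 :=
    { toFun := fun v => ⟨fun j => a j v, memℓp_two_of_summable (ha v).1⟩
      map_add' := fun v w => by ext j; exact map_add (a j) v w
      map_smul' := fun s v => by ext j; exact map_smul (a j) s v }
  have hb : ∀ v, ‖T₀ v‖ ≤ 1 * ‖v‖ := fun v => by
    rw [one_mul, ← sq_le_sq₀ (norm_nonneg _) (norm_nonneg _), ← (lp_two_hasSum_norm_sq _).tsum_eq]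
    exact (ha v).2
  exact ⟨T₀.mkContinuous 1 hb, T₀.mkContinuous_norm_le zero_le_one hb, fun v j => rfl⟩

/-- Evaluation of a square-summable sequence at an index. -/
def lpTwoEval (E : Type*) [NormedAddCommGroup E] [NormedSpace ℂ E] (j : ℕ) :
    lp (fun _ : ℕ => E) 2 →ₗ[ℂ] E where
  toFun f := f j
  map_add' _ _ := rfl
  map_smul' _ _ := rfl

lemma lp_two_adjoint_apply {E G : Type*} [NormedAddCommGroup E] [InnerProductSpace ℂ E]
    [CompleteSpace E] [NormedAddCommGroup G] [InnerProductSpace ℂ G] [CompleteSpace G]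
    (T : lp (fun _ : ℕ => E) 2 →L[ℂ] G) (x : G) (j : ℕ) (u : E) :
    ⟪u, T.adjoint x j⟫_ℂ = ⟪T (lp.single 2 j u), x⟫_ℂ := by
  rw [← ContinuousLinearMap.adjoint_inner_right, lp.inner_single_left]

/-- A weighted shift together with a diagonal operator that completes it to a co-isometry. -/
lemma exists_weighted_shift {Y : Type*} [NormedAddCommGroup Y] [InnerProductSpace ℂ Y]
    [CompleteSpace Y] (w d : ℕ → ℝ) (hw0 : w 0 = 0) (hwd : ∀ j, w j ^ 2 + d j ^ 2 = 1) :
    ∃ T P : lp (fun _ : ℕ => Y) 2 →L[ℂ] lp (fun _ : ℕ => Y) 2,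
      (∀ f, T f 0 = 0) ∧ (∀ f j, T f (j + 1) = (w (j + 1) : ℂ) • f j) ∧
      (∀ f j, P f j = (d j : ℂ) • f j) ∧
      ∀ x, ‖T.adjoint x‖ ^ 2 + ‖P.adjoint x‖ ^ 2 = ‖x‖ ^ 2 := by
  have hd1 : ∀ j, d j ^ 2 ≤ 1 := fun j => by nlinarith [hwd j, sq_nonneg (w j)]
  have hw1 : ∀ j, w j ^ 2 ≤ 1 := fun j => by nlinarith [hwd j, sq_nonneg (d j)]
  obtain ⟨P, -, hP⟩ := exists_lp_two_clm (fun j => (d j : ℂ) • lpTwoEval Y j) fun v => by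
    have hle : ∀ j, ‖((d j : ℂ) • lpTwoEval Y j) v‖ ^ 2 ≤ ‖v j‖ ^ 2 := fun j => by
      change ‖(d j : ℂ) • v j‖ ^ 2 ≤ _
      rw [norm_smul, mul_pow, Complex.norm_real, Real.norm_eq_abs, sq_abs]
      exact mul_le_of_le_one_left (sq_nonneg _) (hd1 j)
    have hv := lp_two_hasSum_norm_sq v
    have hs := Summable.of_nonneg_of_le (fun j => sq_nonneg _) hle hv.summable
    exact ⟨hs, (hs.tsum_le_tsum hle hv.summable).trans hv.tsum_eq.le⟩
  obtain ⟨T, -, hT⟩ := exists_lp_two_clm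
      (fun j => (w j : ℂ) • lpTwoEval Y (j - 1)) fun v => by
    have hle : ∀ j, ‖((w (j + 1) : ℂ) • lpTwoEval Y (j + 1 - 1)) v‖ ^ 2 ≤ ‖v j‖ ^ 2 := fun j => by
      change ‖(w (j + 1) : ℂ) • v j‖ ^ 2 ≤ _
      rw [norm_smul, mul_pow, Complex.norm_real, Real.norm_eq_abs, sq_abs]
      exact mul_le_of_le_one_left (sq_nonneg _) (hw1 _)
    have hv := lp_two_hasSum_norm_sq v
    have hs := Summable.of_nonneg_of_le (fun j => sq_nonneg _) hle hv.summable
    have hs' := (summable_nat_add_iff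
      (f := fun j => ‖((w j : ℂ) • lpTwoEval Y (j - 1)) v‖ ^ 2) 1).1 hs
    refine ⟨hs', ?_⟩
    rw [hs'.tsum_eq_zero_add]
    simp only [hw0, Complex.ofReal_zero, zero_smul, LinearMap.zero_apply, norm_zero]
    simpa using! (hs.tsum_le_tsum hle hv.summable).trans hv.tsum_eq.le
  have hT0 : ∀ f, T f 0 = 0 := fun f => by simp [hT, hw0]
  have hTs : ∀ f j, T f (j + 1) = (w (j + 1) : ℂ) • f j := fun f j => hT f (j + 1)
  have hPs : ∀ f j, P f j = (d j : ℂ) • f j := hP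
  refine ⟨T, P, hT0, hTs, hPs, fun x => ?_⟩
  have hTa : ∀ j, T.adjoint x j = (w (j + 1) : ℂ) • x (j + 1) := fun j => by
    refine ext_inner_left ℂ fun u => ?_
    have : T (lp.single 2 j u) = lp.single 2 (j + 1) ((w (j + 1) : ℂ) • u) := by
      ext i
      rcases i with _ | i
      · rw [hT0, lp.single_apply_ne _ _ _ (by omega)]
      · rw [hTs]
        rcases eq_or_ne i j with rfl | h
        · rw [lp.single_apply_self, lp.single_apply_self]
        · rw [lp.single_apply_ne _ _ _ h, lp.single_apply_ne _ _ _ (by omega), smul_zero]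
    rw [lp_two_adjoint_apply, this, lp.inner_single_left, inner_smul_left, inner_smul_right,
      Complex.conj_ofReal]
  have hPa : ∀ j, P.adjoint x j = (d j : ℂ) • x j := fun j => by
    refine ext_inner_left ℂ fun u => ?_
    have : P (lp.single 2 j u) = lp.single 2 j ((d j : ℂ) • u) := by
      ext i
      rw [hPs]
      rcases eq_or_ne i j with rfl | h
      · rw [lp.single_apply_self, lp.single_apply_self]
      · rw [lp.single_apply_ne _ _ _ h, lp.single_apply_ne _ _ _ h, smul_zero]
    rw [lp_two_adjoint_apply, this, lp.inner_single_left, inner_smul_left, inner_smul_right,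
      Complex.conj_ofReal]
  have h1 : HasSum (fun j => w j ^ 2 * ‖x j‖ ^ 2) (‖T.adjoint x‖ ^ 2) := by
    rw [← hasSum_nat_add_iff' 1]
    simpa [hTa, norm_smul, mul_pow, hw0] using lp_two_hasSum_norm_sq (T.adjoint x)
  have h2 : HasSum (fun j => d j ^ 2 * ‖x j‖ ^ 2) (‖P.adjoint x‖ ^ 2) := by
    simpa [hPa, norm_smul, mul_pow] using lp_two_hasSum_norm_sq (P.adjoint x)
  refine (h1.add h2).unique ?_
  simpa only [← add_mul, hwd, one_mul] using lp_two_hasSum_norm_sq x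

lemma IsWeightSeq.summable_pow_div_sqrt {β : ℕ → ℝ} (hβ : IsWeightSeq β) {r : ℝ}
    (hr0 : 0 ≤ r) (hr1 : r < 1) : Summable fun j => r ^ j * (Real.sqrt (β j))⁻¹ := by
  obtain ⟨hpos, -, hlim⟩ := hβ
  obtain ⟨ρ, hrρ, hρ1⟩ := exists_between hr1
  have hρ0 : 0 < ρ := hr0.trans_lt hrρ
  have hev : ∀ᶠ j : ℕ in atTop, ρ ^ 2 < β j ^ ((1 : ℝ) / j) := by
    refine eventually_lt_of_lt_liminf (lt_of_lt_of_le ?_ hlim)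
      ⟨0, eventually_map.2 <| .of_forall fun j => Real.rpow_nonneg (hpos j).le _⟩
    exact pow_lt_one₀ hρ0.le hρ1 two_ne_zero
  have hgeo : Summable fun j : ℕ => (r / ρ) ^ j :=
    summable_geometric_of_lt_one (by positivity) ((div_lt_one hρ0).2 hrρ)
  refine summable_of_isBigO_nat hgeo (Asymptotics.IsBigO.of_bound 1 ?_)
  filter_upwards [hev, eventually_ge_atTop 1] with j hj hj1
  have hj0 : (j : ℝ) ≠ 0 := by positivity
  have h1 : (ρ ^ j) ^ 2 ≤ β j := by
    have h2 := pow_le_pow_left₀ (by positivity) hj.le j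
    rw [← Real.rpow_natCast (β j ^ _), ← Real.rpow_mul (hpos j).le, one_div_mul_cancel hj0,
      Real.rpow_one] at h2
    rwa [← pow_mul, mul_comm, pow_mul]
  have h3 : ρ ^ j ≤ Real.sqrt (β j) := Real.le_sqrt_of_sq_le h1
  have h4 : (Real.sqrt (β j))⁻¹ ≤ (ρ ^ j)⁻¹ := inv_anti₀ (by positivity) h3
  rw [one_mul, Real.norm_of_nonneg (by positivity), Real.norm_of_nonneg (by positivity), div_pow,
    div_eq_mul_inv]
  gcongr

lemma weight_diff_bounds {β c : ℕ → ℝ} (hβ : IsWeightSeq β) (hmono : ∀ j, β (j + 1) ≤ β j)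
    (hc0 : c 0 = 1) (hcs : ∀ j, c (j + 1) = (β (j + 1))⁻¹ - (β j)⁻¹) (j : ℕ) :
    0 ≤ c j ∧ c j ≤ (β j)⁻¹ := by
  have hpos := hβ.1
  rcases j with _ | j
  · simp [hc0, hβ.2.1]
  · rw [hcs]
    exact ⟨sub_nonneg.2 (inv_anti₀ (hpos _) (hmono j)),
      sub_le_self _ (inv_nonneg.2 (hpos j).le)⟩

lemma exists_lp_two_multiplier {U Y : Type*}
    [NormedAddCommGroup U] [InnerProductSpace ℂ U] [NormedAddCommGroup Y] [InnerProductSpace ℂ Y]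
    {β : ℕ → ℝ} (hβ : ∀ j, 0 < β j) {Sc : ℕ → (U →L[ℂ] Y)}
    (hS : IsContractiveMultiplier β Sc) :
    ∃ M : lp (fun _ : ℕ => U) 2 →L[ℂ] lp (fun _ : ℕ => Y) 2, ‖M‖ ≤ 1 ∧
      ∀ k u l, M (lp.single 2 k u) l =
        if k ≤ l then (Real.sqrt (β l) : ℂ) • Sc (l - k) u else 0 := by
  obtain ⟨M, hM1, hM⟩ := exists_lp_two_clm (fun l => (Real.sqrt (β l) : ℂ) •
      ∑ j ∈ Finset.range (l + 1), (Sc j : U →ₗ[ℂ] Y).comp (lpTwoEval U (l - j))) fun v => by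
    have hv := lp_two_hasSum_norm_sq v
    obtain ⟨h1, h2⟩ := hS v hv.summable
    rw [hv.tsum_eq] at h2
    have he : ∀ l, ‖((Real.sqrt (β l) : ℂ) •
        ∑ j ∈ Finset.range (l + 1), (Sc j : U →ₗ[ℂ] Y).comp (lpTwoEval U (l - j))) v‖ ^ 2 =
        β l * ‖∑ j ∈ Finset.range (l + 1), Sc j (v (l - j))‖ ^ 2 := fun l => by
      rw [LinearMap.smul_apply, norm_smul, mul_pow, Complex.norm_real, Real.norm_eq_abs, sq_abs,
        Real.sq_sqrt (hβ l).le, LinearMap.sum_apply]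
      rfl
    simp only [he]
    exact ⟨h1, h2⟩
  refine ⟨M, hM1, fun k u l => ?_⟩
  rw [hM, LinearMap.smul_apply, LinearMap.sum_apply]
  change _ • ∑ j ∈ Finset.range (l + 1), Sc j (lp.single (E := fun _ : ℕ => U) 2 k u (l - j)) = _
  split_ifs with hkl
  · rw [Finset.sum_eq_single (l - k)]
    · rw [Nat.sub_sub_self hkl, lp.single_apply_self]
    · intro j hj hjk
      rw [lp.single_apply_ne _ _ _ (by have := Finset.mem_range.1 hj; omega), map_zero]
    · intro h
      exact absurd (Finset.mem_range.2 (by omega)) h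
  · rw [Finset.sum_eq_zero, smul_zero]
    intro j _
    rw [lp.single_apply_ne _ _ _ (by omega), map_zero]

theorem IsContractiveMultiplier.exists_isSchur {U Y : Type*}
    [NormedAddCommGroup U] [InnerProductSpace ℂ U] [CompleteSpace U]
    [NormedAddCommGroup Y] [InnerProductSpace ℂ Y] [CompleteSpace Y]
    {β : ℕ → ℝ} (hβ : IsWeightSeq β) (hmono : ∀ j, β (j + 1) ≤ β j)
    {c : ℕ → ℝ} (hc0 : c 0 = 1) (hcs : ∀ j, c (j + 1) = (β (j + 1))⁻¹ - (β j)⁻¹)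
    {S : ℂ → (U →L[ℂ] Y)} {Sc : ℕ → (U →L[ℂ] Y)}
    (hTaylor : ∀ z ∈ ball (0 : ℂ) 1, HasSum (fun j => z ^ j • Sc j) (S z))
    (hS : IsContractiveMultiplier β Sc) :
    ∃ F : ℂ → (U →L[ℂ] lp (fun _ : ℕ => Y) 2), IsSchur F ∧ ∀ z ∈ ball (0 : ℂ) 1, ∀ u : U,
      HasSum (fun j => ((Real.sqrt (c j) : ℂ) * z ^ j) • (F z u) j) (S z u) := by
  have hpos := hβ.1
  set s : ℕ → ℝ := fun j => Real.sqrt (β j) with hs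
  have hs0 : ∀ j, 0 < s j := fun j => Real.sqrt_pos.2 (hpos j)
  have hs2 : ∀ j, s j ^ 2 = β j := fun j => Real.sq_sqrt (hpos j).le
  have hc := weight_diff_bounds hβ hmono hc0 hcs
  set w : ℕ → ℝ := fun j => if j = 0 then 0 else s j / s (j - 1) with hw
  set d : ℕ → ℝ := fun j => s j * Real.sqrt (c j) with hd
  have hwd : ∀ j, w j ^ 2 + d j ^ 2 = 1 := by
    rintro (_ | j)
    · simp [hw, hd, hc0, hs, hβ.2.1]
    · have h1 := (hpos j).ne'
      have h2 := (hpos (j + 1)).ne'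
      simp only [hw, hd, div_pow, mul_pow, hs2, Nat.add_sub_cancel, Nat.succ_ne_zero, if_false]
      rw [Real.sq_sqrt (hc _).1, hcs]
      field_simp
      ring
  obtain ⟨T, P, hT0, hT, hP, hTP⟩ := exists_weighted_shift (Y := Y) w d (by simp [hw]) hwd
  obtain ⟨M, hM1, hM⟩ := exists_lp_two_multiplier hpos hS
  obtain ⟨Q, hQ⟩ := exists_defect M.adjoint (by simpa using hM1)
  have hTM : ∀ k u, T (M (lp.single 2 k u)) = M (lp.single 2 (k + 1) u) := fun k u => by
    ext l
    rcases l with _ | l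
    · rw [hT0, hM, if_neg (by omega)]
    · rw [hT, hM, hM]
      by_cases hkl : k ≤ l
      · rw [if_pos hkl, if_pos (by omega), smul_smul, Nat.add_sub_add_right, ← Complex.ofReal_mul]
        congr 3
        simp only [hw, Nat.succ_ne_zero, if_false, Nat.add_sub_cancel]
        exact div_mul_cancel₀ _ (hs0 l).ne'
      · rw [if_neg hkl, if_neg (by omega), smul_zero]
  let M₀ : U →L[ℂ] lp (fun _ : ℕ => Y) 2 :=
    M.comp (lp.singleContinuousLinearMap ℂ (fun _ : ℕ => U) 2 0)
  have hM₀ : ∀ u, M₀ u = M (lp.single 2 0 u) := fun u => rfl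
  obtain ⟨F, hF, hFe⟩ := exists_schur_transfer T P M₀ Q fun x => by
    have h0 : M₀.adjoint x = M.adjoint x 0 := by
      refine ext_inner_left ℂ fun u => ?_
      rw [ContinuousLinearMap.adjoint_inner_right, hM₀, lp_two_adjoint_apply]
    have h1 : ∀ j, M.adjoint (T.adjoint x) j = M.adjoint x (j + 1) := fun j => by
      refine ext_inner_left ℂ fun u => ?_
      rw [lp_two_adjoint_apply, lp_two_adjoint_apply, ContinuousLinearMap.adjoint_inner_right, hTM]
    have h2 := lp_two_hasSum_norm_sq (M.adjoint x)
    have h3 := lp_two_hasSum_norm_sq (M.adjoint (T.adjoint x))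
    simp only [h1] at h3
    have h4 := h2.summable.tsum_eq_zero_add
    rw [h2.tsum_eq, h3.tsum_eq] at h4
    rw [h0]
    linarith [hQ x, hQ (T.adjoint x), hTP x]
  refine ⟨F, hF, fun z hz u => ?_⟩
  obtain ⟨x, hx⟩ := hFe z hz u
  set φ := Q.adjoint x with hφ
  set y := F z u with hy
  have hz1 : ‖z‖ < 1 := by simpa using hz
  have hsum := hβ.summable_pow_div_sqrt (norm_nonneg z) hz1
  have hSu : HasSum (fun j => z ^ j • Sc j u) (S z u) := by
    simpa using! (hTaylor z hz).mapL (ContinuousLinearMap.apply ℂ Y u)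
  have hsC : ∀ j, (s j : ℂ) ≠ 0 := fun j => Complex.ofReal_ne_zero.2 (hs0 j).ne'
  have hpart : ∀ N, ∑ j ∈ Finset.range (N + 1), ((Real.sqrt (c j) : ℂ) * z ^ j) • y j =
      ∑ j ∈ Finset.range (N + 1), z ^ j • Sc j u + (z ^ (N + 1) * (s N : ℂ)⁻¹) • φ N := by
    intro N
    induction N with
    | zero =>
      have := congrArg (fun f : lp (fun _ : ℕ => Y) 2 => (s 0 : ℂ)⁻¹ • f 0) hx
      simp only [lp.coeFn_add, Pi.add_apply, lp.coeFn_smul, Pi.smul_apply, hT0, hP, hM₀, hM,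
        zero_add, le_refl, if_true, smul_add, smul_smul, hd, Complex.ofReal_mul, Nat.sub_zero]
        at this
      rw [inv_mul_cancel_left₀ (hsC 0), show (Real.sqrt (β 0) : ℂ) = s 0 from rfl,
        inv_mul_cancel₀ (hsC 0), one_smul] at this
      simp only [zero_add, Finset.sum_range_one, pow_zero, mul_one, one_smul, pow_one]
      rw [this, add_comm, mul_comm]
    | succ N ih =>
      have := congrArg (fun f : lp (fun _ : ℕ => Y) 2 => (z ^ (N + 1) * (s (N + 1) : ℂ)⁻¹) •
        f (N + 1)) hx
      simp only [lp.coeFn_add, Pi.add_apply, lp.coeFn_smul, Pi.smul_apply, hT, hP, hM₀, hM,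
        zero_le, if_true, smul_add, smul_smul, hd, Complex.ofReal_mul, Nat.sub_zero]
        at this
      have e1 : z ^ (N + 1) * (s (N + 1) : ℂ)⁻¹ * (w (N + 1) : ℂ) = z ^ (N + 1) * (s N : ℂ)⁻¹ := by
        have := hsC N
        have := hsC (N + 1)
        simp only [hw, Nat.succ_ne_zero, if_false, Nat.add_sub_cancel, Complex.ofReal_div]
        field_simp
      have e2 : ∀ a : ℂ, z ^ (N + 1) * (s (N + 1) : ℂ)⁻¹ * ((s (N + 1) : ℂ) * a) =
          a * z ^ (N + 1) := fun a => by
        have := hsC (N + 1)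
        field_simp
      have e3 : z ^ (N + 1) * (s (N + 1) : ℂ)⁻¹ * (Real.sqrt (β (N + 1)) : ℂ) = z ^ (N + 1) := by
        rw [show (Real.sqrt (β (N + 1)) : ℂ) = s (N + 1) from rfl]
        exact inv_mul_cancel_right₀ (hsC _) _
      have e4 : z ^ (N + 1) * (s (N + 1) : ℂ)⁻¹ * z = z ^ (N + 1 + 1) * (s (N + 1) : ℂ)⁻¹ := by
        ring
      rw [e1, e2, e3, e4] at this
      rw [Finset.sum_range_succ, ih, Finset.sum_range_succ _ (N + 1), add_assoc, this]
      abel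
  have hcs' : ∀ j, Real.sqrt (c j) ≤ (s j)⁻¹ := fun j => by
    rw [hs, ← Real.sqrt_inv]
    exact Real.sqrt_le_sqrt (hc j).2
  have hle : ∀ (f : lp (fun _ : ℕ => Y) 2) j, ‖f j‖ ≤ ‖f‖ := fun f j =>
    lp.norm_apply_le_norm two_ne_zero f j
  have hsummable : Summable fun j => ((Real.sqrt (c j) : ℂ) * z ^ j) • y j := by
    refine .of_norm_bounded (hsum.mul_right ‖y‖) fun j => ?_
    rw [norm_smul, norm_mul, norm_pow, Complex.norm_real, Real.norm_of_nonneg (Real.sqrt_nonneg _),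
      mul_comm (Real.sqrt _)]
    gcongr
    exacts [hcs' j, hle y j]
  rw [hsummable.hasSum_iff_tendsto_nat, ← tendsto_add_atTop_iff_nat 1]
  simp only [hpart]
  have htail : Tendsto (fun N => (z ^ (N + 1) * (s N : ℂ)⁻¹) • φ N) atTop (nhds 0) := by
    refine squeeze_zero_norm (fun N => ?_) (by
      simpa using (hsum.tendsto_atTop_zero.const_mul ‖z‖).mul_const ‖φ‖)
    rw [norm_smul, norm_mul, norm_pow, norm_inv, Complex.norm_real, Real.norm_of_nonneg (hs0 N).le,
      pow_succ', mul_assoc ‖z‖]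
    gcongr
    exact hle φ N
  simpa using ((tendsto_add_atTop_iff_nat 1).2 hSu.tendsto_sum_nat).add htail

lemma HasSum.shift {E : Type*} [NormedAddCommGroup E] {a : ℕ → E} {s : E} (h : HasSum a s)
    (k : ℕ) : HasSum (fun n => if k ≤ n then a (n - k) else 0) s := by
  rw [← hasSum_nat_add_iff' k, Finset.sum_eq_zero, sub_zero]
  · simpa using h
  · intro i hi
    exact if_neg (not_le.2 (Finset.mem_range.1 hi))

lemma summable_pow_mul_norm {E : Type*} [NormedAddCommGroup E] [NormedSpace ℂ E] {a : ℕ → E}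
    (h : ∀ z ∈ ball (0 : ℂ) 1, Summable fun n => z ^ n • a n) {r : ℝ} (hr0 : 0 ≤ r) (hr1 : r < 1) :
    Summable fun n => r ^ n * ‖a n‖ := by
  obtain ⟨ρ, hrρ, hρ1⟩ := exists_between hr1
  have hρ0 : 0 < ρ := hr0.trans_lt hrρ
  have ht := (h (ρ : ℂ) (by simpa [abs_of_pos hρ0] using hρ1)).tendsto_atTop_zero.norm
  have hgeo : Summable fun j : ℕ => (r / ρ) ^ j :=
    summable_geometric_of_lt_one (by positivity) ((div_lt_one hρ0).2 hrρ)
  refine summable_of_isBigO_nat hgeo (Asymptotics.IsBigO.of_bound 1 ?_)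
  rw [norm_zero] at ht
  filter_upwards [ht.eventually_lt_const one_pos] with n hn
  rw [norm_smul, norm_pow, Complex.norm_real, Real.norm_of_nonneg hρ0.le] at hn
  rw [one_mul, Real.norm_of_nonneg (by positivity), Real.norm_of_nonneg (by positivity), div_pow,
    le_div_iff₀ (by positivity)]
  calc r ^ n * ‖a n‖ * ρ ^ n = r ^ n * (ρ ^ n * ‖a n‖) := by ring
    _ ≤ r ^ n := mul_le_of_le_one_right (by positivity) hn.le

section Fourier

open MeasureTheory intervalIntegral

/-- The point `exp (t * I)` of the unit circle. -/
def unitPt (t : ℝ) : ℂ := Complex.exp (t * Complex.I)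

lemma norm_unitPt (t : ℝ) : ‖unitPt t‖ = 1 := Complex.norm_exp_ofReal_mul_I t

lemma unitPt_ne_zero (t : ℝ) : unitPt t ≠ 0 := Complex.exp_ne_zero _

@[fun_prop]
lemma continuous_unitPt : Continuous unitPt := by
  unfold unitPt; fun_prop

@[fun_prop]
lemma continuous_unitPt_pow_inv (l : ℕ) : Continuous fun t => (unitPt t ^ l)⁻¹ :=
  (continuous_unitPt.pow l).inv₀ fun t => pow_ne_zero l (unitPt_ne_zero t)

lemma integral_unitPt (l n : ℕ) :
    ∫ t in (0 : ℝ)..2 * Real.pi, (unitPt t ^ l)⁻¹ * unitPt t ^ n =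
      if n = l then (2 * Real.pi : ℂ) else 0 := by
  have h : ∀ t : ℝ, (unitPt t ^ l)⁻¹ * unitPt t ^ n =
      Complex.exp ((((n : ℂ) - l) * Complex.I) * t) := fun t => by
    simp only [unitPt, ← Complex.exp_nat_mul, ← Complex.exp_neg, ← Complex.exp_add]
    congr 1
    ring
  split_ifs with hnl
  · subst hnl
    simp [h]
  · have hc : ((n : ℂ) - l) * Complex.I ≠ 0 :=
      mul_ne_zero (sub_ne_zero.2 (by exact_mod_cast hnl)) Complex.I_ne_zero
    simp only [h]
    rw [integral_exp_mul_complex hc]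
    have : Complex.exp (((n : ℂ) - l) * Complex.I * (2 * Real.pi : ℝ)) = 1 := by
      rw [← Complex.exp_int_mul_two_pi_mul_I ((n : ℤ) - l)]
      congr 1
      push_cast
      ring
    rw [this]
    simp

variable {E : Type*} [NormedAddCommGroup E]

lemma continuous_of_hasSum_unitPt [NormedSpace ℂ E] [CompleteSpace E] {a : ℕ → E} {G : ℝ → E}
    (ha : Summable fun n => ‖a n‖) (hG : ∀ t, HasSum (fun n => unitPt t ^ n • a n) (G t)) :
    Continuous G := by
  have : G = fun t => ∑' n, unitPt t ^ n • a n := funext fun t => (hG t).tsum_eq.symm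
  rw [this]
  refine continuous_tsum (fun n => by fun_prop) ha fun n t => ?_
  simp [norm_smul, norm_unitPt]

lemma integral_unitPt_smul_eq [NormedSpace ℂ E] [CompleteSpace E] {a : ℕ → E} {G : ℝ → E}
    (ha : Summable fun n => ‖a n‖) (hG : ∀ t, HasSum (fun n => unitPt t ^ n • a n) (G t)) (l : ℕ) :
    ∫ t in (0 : ℝ)..2 * Real.pi, (unitPt t ^ l)⁻¹ • G t = (2 * Real.pi : ℂ) • a l := by
  let f : ℕ → C(ℝ, E) := fun n =>
    ⟨fun t => (unitPt t ^ l)⁻¹ • (unitPt t ^ n • a n), by fun_prop⟩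
  have hs : Summable fun n => ‖(f n).restrict
      (⟨Set.uIcc 0 (2 * Real.pi), isCompact_uIcc⟩ : TopologicalSpace.Compacts ℝ)‖ := by
    refine Summable.of_nonneg_of_le (fun _ => norm_nonneg _) (fun n => ?_) ha
    refine (ContinuousMap.norm_le _ (norm_nonneg _)).2 fun t => ?_
    simp [f, norm_smul, norm_unitPt]
  have h1 := hasSum_intervalIntegral_of_summable_norm hs
  have h2 : ∀ n, ∫ t in (0 : ℝ)..2 * Real.pi, f n t =
      if n = l then (2 * Real.pi : ℂ) • a l else 0 := fun n => by
    simp only [f, ContinuousMap.coe_mk, smul_smul]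
    rw [intervalIntegral.integral_smul_const, integral_unitPt]
    split_ifs with h
    · rw [h]
    · rw [zero_smul]
  have h3 : ∀ t, ∑' n, f n t = (unitPt t ^ l)⁻¹ • G t := fun t => ((hG t).const_smul _).tsum_eq
  simp only [h2, h3] at h1
  exact h1.unique (hasSum_ite_eq l _)

variable [InnerProductSpace ℂ E] [CompleteSpace E]

lemma integral_re_inner_partial_sum {a : ℕ → E} {G : ℝ → E}
    (ha : Summable fun n => ‖a n‖) (hG : ∀ t, HasSum (fun n => unitPt t ^ n • a n) (G t)) (N : ℕ) :
    ∫ t in (0 : ℝ)..2 * Real.pi, (⟪∑ l ∈ Finset.range N, unitPt t ^ l • a l, G t⟫_ℂ).re =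
      2 * Real.pi * ∑ l ∈ Finset.range N, ‖a l‖ ^ 2 := by
  have hGc := continuous_of_hasSum_unitPt ha hG
  have h : ∀ t, (⟪∑ l ∈ Finset.range N, unitPt t ^ l • a l, G t⟫_ℂ).re =
      ∑ l ∈ Finset.range N, (Complex.reCLM.comp ((innerSL ℂ (a l)).restrictScalars ℝ))
        ((unitPt t ^ l)⁻¹ • G t) := fun t => by
    rw [sum_inner, Complex.re_sum]
    refine Finset.sum_congr rfl fun l _ => ?_
    simp only [ContinuousLinearMap.comp_apply, ContinuousLinearMap.coe_restrictScalars',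
      innerSL_apply_apply, Complex.reCLM_apply]
    rw [inner_smul_left, inner_smul_right, map_pow, ← inv_pow,
      Complex.inv_eq_conj (norm_unitPt t)]
  simp only [h]
  rw [intervalIntegral.integral_finsetSum, Finset.mul_sum]
  · refine Finset.sum_congr rfl fun l _ => ?_
    rw [ContinuousLinearMap.intervalIntegral_comp_comm, integral_unitPt_smul_eq ha hG]
    · simp only [ContinuousLinearMap.comp_apply, ContinuousLinearMap.coe_restrictScalars',
        innerSL_apply_apply, Complex.reCLM_apply]
      rw [inner_smul_right, inner_self_eq_norm_sq_to_K]
      have he : (2 * Real.pi : ℂ) * (‖a l‖ : ℂ) ^ 2 = (2 * Real.pi * ‖a l‖ ^ 2 : ℝ) := by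
        push_cast
        rfl
      exact congrArg Complex.re he
    · exact Continuous.intervalIntegrable (by fun_prop) _ _
  · intro l _
    exact Continuous.intervalIntegrable (by fun_prop) _ _

lemma integral_norm_sq_partial_sum (a : ℕ → E) (N : ℕ) :
    ∫ t in (0 : ℝ)..2 * Real.pi, ‖∑ l ∈ Finset.range N, unitPt t ^ l • a l‖ ^ 2 =
      2 * Real.pi * ∑ l ∈ Finset.range N, ‖a l‖ ^ 2 := by
  let b : ℕ → E := fun l => if l ∈ Finset.range N then a l else 0
  have hb : ∀ l ∈ Finset.range N, b l = a l := fun l hl => if_pos hl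
  have hb0 : ∀ l ∉ Finset.range N, b l = 0 := fun l hl => if_neg hl
  have hsum : ∀ t, ∑ l ∈ Finset.range N, unitPt t ^ l • a l =
      ∑ l ∈ Finset.range N, unitPt t ^ l • b l := fun t =>
    Finset.sum_congr rfl fun l hl => by rw [hb l hl]
  have key := integral_re_inner_partial_sum (a := b)
    (G := fun t => ∑ l ∈ Finset.range N, unitPt t ^ l • b l)
    (summable_of_ne_finset_zero (s := Finset.range N) fun l hl => by rw [hb0 l hl, norm_zero])
    (fun t => hasSum_sum_of_ne_finset_zero fun l hl => by rw [hb0 l hl, smul_zero]) N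
  rw [Finset.sum_congr rfl fun l hl => by rw [hb l hl]] at key
  rw [← key]
  congr 1
  ext t
  rw [hsum, ← inner_self_eq_norm_sq (𝕜 := ℂ)]
  rfl

lemma sum_norm_sq_le_integral {a : ℕ → E} {G : ℝ → E}
    (ha : Summable fun n => ‖a n‖) (hG : ∀ t, HasSum (fun n => unitPt t ^ n • a n) (G t)) (N : ℕ) :
    2 * Real.pi * ∑ l ∈ Finset.range N, ‖a l‖ ^ 2 ≤
      ∫ t in (0 : ℝ)..2 * Real.pi, ‖G t‖ ^ 2 := by
  have hGc := continuous_of_hasSum_unitPt ha hG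
  have hpt : ∀ t, 2 * (⟪∑ l ∈ Finset.range N, unitPt t ^ l • a l, G t⟫_ℂ).re -
      ‖∑ l ∈ Finset.range N, unitPt t ^ l • a l‖ ^ 2 ≤ ‖G t‖ ^ 2 := fun t => by
    have := norm_sub_sq (𝕜 := ℂ) (∑ l ∈ Finset.range N, unitPt t ^ l • a l) (G t)
    rw [RCLike.re_to_complex] at this
    nlinarith [sq_nonneg ‖∑ l ∈ Finset.range N, unitPt t ^ l • a l - G t‖]
  have hi1 : IntervalIntegrable
      (fun t => 2 * (⟪∑ l ∈ Finset.range N, unitPt t ^ l • a l, G t⟫_ℂ).re) volume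
      0 (2 * Real.pi) :=
    Continuous.intervalIntegrable
      (continuous_const.mul (Complex.continuous_re.comp (by fun_prop))) _ _
  have hi2 : IntervalIntegrable
      (fun t => ‖∑ l ∈ Finset.range N, unitPt t ^ l • a l‖ ^ 2) volume 0 (2 * Real.pi) :=
    Continuous.intervalIntegrable (by fun_prop) _ _
  have := intervalIntegral.integral_mono (by positivity) (hi1.sub hi2)
    (Continuous.intervalIntegrable (by fun_prop) _ _ : IntervalIntegrable
      (fun t => ‖G t‖ ^ 2) volume 0 (2 * Real.pi)) hpt
  rw [intervalIntegral.integral_sub hi1 hi2, intervalIntegral.integral_const_mul,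
    integral_re_inner_partial_sum ha hG, integral_norm_sq_partial_sum] at this
  linarith

end Fourier

lemma IsSchur.exists_hasSum {U V : Type*} [NormedAddCommGroup U] [NormedSpace ℂ U]
    [NormedAddCommGroup V] [NormedSpace ℂ V] [CompleteSpace V]
    {F : ℂ → (U →L[ℂ] V)} (hF : IsSchur F) :
    ∃ Fc : ℕ → (U →L[ℂ] V), ∀ z ∈ ball (0 : ℂ) 1, HasSum (fun n => z ^ n • Fc n) (F z) := by
  refine ⟨fun n => (n.factorial : ℂ)⁻¹ • iteratedDeriv n F 0, fun z hz => ?_⟩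
  have := Complex.hasSum_taylorSeries_on_ball hF.1.differentiableOn hz
  simp only [sub_zero] at this
  exact (funext fun n => smul_comm _ _ _ : (fun n : ℕ => (n.factorial : ℂ)⁻¹ • z ^ n •
    iteratedDeriv n F 0) = fun n => z ^ n • (n.factorial : ℂ)⁻¹ • iteratedDeriv n F 0) ▸ this

lemma hasSum_mul_partial_sum {U V : Type*} [NormedAddCommGroup U] [NormedSpace ℂ U]
    [NormedAddCommGroup V] [NormedSpace ℂ V] {F : ℂ → (U →L[ℂ] V)} {Fc : ℕ → (U →L[ℂ] V)}
    (hFc : ∀ z ∈ ball (0 : ℂ) 1, HasSum (fun n => z ^ n • Fc n) (F z)) (h : ℕ → U) (N : ℕ)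
    {z : ℂ} (hz : z ∈ ball (0 : ℂ) 1) :
    HasSum (fun n => z ^ n • ∑ k ∈ Finset.range N, if k ≤ n then Fc (n - k) (h k) else 0)
      (F z (∑ k ∈ Finset.range N, z ^ k • h k)) := by
  simp only [map_sum, map_smul, Finset.smul_sum]
  refine hasSum_sum fun k _ => ?_
  have h1 : HasSum (fun n => z ^ n • Fc n (h k)) (F z (h k)) := by
    simpa using! (hFc z hz).mapL (ContinuousLinearMap.apply ℂ V (h k))
  convert (h1.const_smul (z ^ k)).shift k using 2 with n
  split_ifs with hkn
  · rw [smul_smul, ← pow_add, Nat.add_sub_cancel' hkn]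
  · rw [smul_zero]

lemma sum_range_succ_eq_sum_ite {M : Type*} [AddCommMonoid M] (a : ℕ → ℕ → M) {l N : ℕ}
    (hl : l < N) :
    ∑ j ∈ Finset.range (l + 1), a j (l - j) =
      ∑ k ∈ Finset.range N, if k ≤ l then a (l - k) k else 0 := by
  rw [← Finset.sum_range_reflect, ← Finset.sum_filter]
  refine Finset.sum_congr ?_ fun k hk => ?_
  · ext k
    simp only [Finset.mem_range, Finset.mem_filter]
    omega
  · have := (Finset.mem_filter.1 hk).2
    congr 1
    omega

lemma tendsto_sum_norm_sq_pow_smul {E : Type*} [NormedAddCommGroup E] [NormedSpace ℂ E]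
    (a : ℕ → E) (N : ℕ) :
    Tendsto (fun r : ℝ => ∑ l ∈ Finset.range N, ‖(r : ℂ) ^ l • a l‖ ^ 2)
      (nhdsWithin 1 (Set.Iio 1)) (nhds (∑ l ∈ Finset.range N, ‖a l‖ ^ 2)) := by
  have hc : Continuous fun r : ℝ => ∑ l ∈ Finset.range N, ‖(r : ℂ) ^ l • a l‖ ^ 2 := by
    fun_prop
  simpa using (hc.tendsto 1).mono_left nhdsWithin_le_nhds

lemma IsSchur.sum_norm_sq_pow_smul_le {U V : Type*} [NormedAddCommGroup U]
    [InnerProductSpace ℂ U] [CompleteSpace U] [NormedAddCommGroup V] [InnerProductSpace ℂ V]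
    [CompleteSpace V] {F : ℂ → (U →L[ℂ] V)} (hF : IsSchur F)
    {h : ℕ → U} {g : ℕ → V} {N : ℕ}
    (hg : ∀ z ∈ ball (0 : ℂ) 1,
      HasSum (fun n => z ^ n • g n) (F z (∑ k ∈ Finset.range N, z ^ k • h k)))
    {r : ℝ} (hr0 : 0 ≤ r) (hr1 : r < 1) :
    ∑ l ∈ Finset.range N, ‖(r : ℂ) ^ l • g l‖ ^ 2 ≤
      ∑ l ∈ Finset.range N, ‖(r : ℂ) ^ l • h l‖ ^ 2 := by
  have hz : ∀ t, (r : ℂ) * unitPt t ∈ ball (0 : ℂ) 1 := fun t => by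
    simpa [norm_unitPt, abs_of_nonneg hr0] using hr1
  have hG : ∀ t, HasSum (fun n => unitPt t ^ n • ((r : ℂ) ^ n • g n))
      (F (r * unitPt t) (∑ k ∈ Finset.range N, unitPt t ^ k • ((r : ℂ) ^ k • h k))) := by
    intro t
    simpa only [smul_smul, ← mul_pow, mul_comm (unitPt t)] using hg _ (hz t)
  have ha : Summable fun n => ‖(r : ℂ) ^ n • g n‖ := by
    have := summable_pow_mul_norm (a := g) (fun z hz => (hg z hz).summable) hr0 hr1
    simpa [norm_smul, abs_of_nonneg hr0] using this
  have h1 := sum_norm_sq_le_integral ha hG N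
  have h2 := integral_norm_sq_partial_sum (fun l => (r : ℂ) ^ l • h l) N
  have hc := continuous_of_hasSum_unitPt ha hG
  have hc' : Continuous fun t => ∑ k ∈ Finset.range N, unitPt t ^ k • ((r : ℂ) ^ k • h k) := by
    fun_prop
  have h3 := intervalIntegral.integral_mono Real.two_pi_pos.le
    ((hc.norm.pow 2).intervalIntegrable (μ := MeasureTheory.volume) 0 (2 * Real.pi))
    ((hc'.norm.pow 2).intervalIntegrable (μ := MeasureTheory.volume) 0 (2 * Real.pi)) fun t => by
      have := (F (r * unitPt t)).le_of_opNorm_le (hF.2 _ (hz t))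
        (∑ k ∈ Finset.range N, unitPt t ^ k • ((r : ℂ) ^ k • h k))
      rw [one_mul] at this
      exact pow_le_pow_left₀ (norm_nonneg _) this 2
  exact le_of_mul_le_mul_left ((h1.trans h3).trans h2.le) Real.two_pi_pos

/-- Multiplication by a Schur function is a contraction on square-summable sequences. -/
lemma IsSchur.sum_norm_sq_le {U V : Type*} [NormedAddCommGroup U]
    [InnerProductSpace ℂ U] [CompleteSpace U] [NormedAddCommGroup V] [InnerProductSpace ℂ V]
    [CompleteSpace V] {F : ℂ → (U →L[ℂ] V)} (hF : IsSchur F) {Fc : ℕ → (U →L[ℂ] V)}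
    (hFc : ∀ z ∈ ball (0 : ℂ) 1, HasSum (fun n => z ^ n • Fc n) (F z)) (h : ℕ → U) (N : ℕ) :
    ∑ l ∈ Finset.range N, ‖∑ j ∈ Finset.range (l + 1), Fc j (h (l - j))‖ ^ 2 ≤
      ∑ l ∈ Finset.range N, ‖h l‖ ^ 2 := by
  rw [Finset.sum_congr rfl fun l hl => by
    rw [sum_range_succ_eq_sum_ite (fun j k => Fc j (h k)) (Finset.mem_range.1 hl)]]
  refine le_of_tendsto_of_tendsto (tendsto_sum_norm_sq_pow_smul
    (fun l => ∑ k ∈ Finset.range N, if k ≤ l then Fc (l - k) (h k) else 0) N)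
    (tendsto_sum_norm_sq_pow_smul h N) ?_
  filter_upwards [Ioo_mem_nhdsLT (zero_lt_one' ℝ)] with r hr
  exact hF.sum_norm_sq_pow_smul_le (fun z hz => hasSum_mul_partial_sum hFc h N hz) hr.1.le hr.2

/-- The Taylor coefficients of `z ↦ Ψ_β z ∘ F z`. -/
lemma taylor_coeff_eq {U Y : Type*}
    [NormedAddCommGroup U] [InnerProductSpace ℂ U]
    [NormedAddCommGroup Y] [InnerProductSpace ℂ Y] [CompleteSpace Y]
    {b : ℕ → ℝ} (hb0 : ∀ j, 0 ≤ b j) (hb : ∀ r : ℝ, 0 ≤ r → r < 1 → Summable fun j => r ^ j * b j)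
    {S : ℂ → (U →L[ℂ] Y)} {Sc : ℕ → (U →L[ℂ] Y)}
    (hTaylor : ∀ z ∈ ball (0 : ℂ) 1, HasSum (fun j => z ^ j • Sc j) (S z))
    {F : ℂ → (U →L[ℂ] lp (fun _ : ℕ => Y) 2)} {Fc : ℕ → (U →L[ℂ] lp (fun _ : ℕ => Y) 2)}
    (hFc : ∀ z ∈ ball (0 : ℂ) 1, HasSum (fun n => z ^ n • Fc n) (F z))
    (hSF : ∀ z ∈ ball (0 : ℂ) 1, ∀ u, HasSum (fun j => ((b j : ℂ) * z ^ j) • (F z u) j) (S z u))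
    (l : ℕ) (u : U) :
    Sc l u = ∑ i ∈ Finset.range (l + 1), (b i : ℂ) • (Fc (l - i) u) i := by
  have hSu : ∀ z ∈ ball (0 : ℂ) 1, HasSum (fun j => z ^ j • Sc j u) (S z u) := fun z hz => by
    simpa using! (hTaylor z hz).mapL (ContinuousLinearMap.apply ℂ Y u)
  have hFu : ∀ z ∈ ball (0 : ℂ) 1, HasSum (fun j => z ^ j • Fc j u) (F z u) := fun z hz => by
    simpa using! (hFc z hz).mapL (ContinuousLinearMap.apply ℂ _ u)
  set q : ℕ → Y := fun l => ∑ p ∈ Finset.HasAntidiagonal.antidiagonal l, (b p.1 : ℂ) • (Fc p.2 u) p.1 with hq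
  have hqS : ∀ z ∈ ball (0 : ℂ) 1, HasSum (fun l => z ^ l • q l) (S z u) := by
    intro z hz
    have hz1 : ‖z‖ < 1 := by simpa using hz
    let f : ℕ × ℕ → Y := fun p => z ^ (p.1 + p.2) • (b p.1 : ℂ) • (Fc p.2 u) p.1
    have hf : Summable f := by
      refine .of_norm_bounded ((hb ‖z‖ (norm_nonneg z) hz1).mul_of_nonneg
        (summable_pow_mul_norm (fun z hz => (hFu z hz).summable) (norm_nonneg z) hz1)
        (fun j => mul_nonneg (by positivity) (hb0 j)) (fun j => by positivity)) fun p => ?_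
      rw [norm_smul, norm_smul, Complex.norm_real, Real.norm_of_nonneg (hb0 _), norm_pow, pow_add]
      calc ‖z‖ ^ p.1 * ‖z‖ ^ p.2 * (b p.1 * ‖(Fc p.2 u) p.1‖)
          ≤ ‖z‖ ^ p.1 * ‖z‖ ^ p.2 * (b p.1 * ‖Fc p.2 u‖) := by
            gcongr
            · exact hb0 _
            · exact lp.norm_apply_le_norm two_ne_zero _ _
        _ = _ := by ring
    have h1 : ∀ i, HasSum (fun n => f (i, n)) (((b i : ℂ) * z ^ i) • (F z u) i) := fun i => by
      have h2 := ((hFu z hz).mapL (lp.evalCLM ℂ (fun _ : ℕ => Y) 2 i)).const_smul ((b i : ℂ) * z ^ i)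
      refine (funext fun n => ?_ : (fun n => f (i, n)) = _) ▸ h2
      change _ = ((b i : ℂ) * z ^ i) • (z ^ n • (Fc n u) i)
      simp only [f, smul_smul, pow_add]
      congr 1
      ring
    have h3 : HasSum f (S z u) := by
      have := hf.hasSum
      rwa [(this.prod_fiberwise h1).unique (hSF z hz u)] at this
    rw [← Finset.HasAntidiagonal.sigmaAntidiagonalEquivProd.hasSum_iff] at h3
    convert h3.sigma fun n => Finset.hasSum _ _ using 2 with n
    rw [hq, Finset.smul_sum]
    refine Finset.sum_congr rfl fun p hp => ?_
    simp only [f]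
    rw [Finset.HasAntidiagonal.mem_antidiagonal.1 hp]
  have hr : ((1 / 2 : ℝ) : ℂ) ≠ 0 := by norm_num
  have hz : ∀ t, ((1 / 2 : ℝ) : ℂ) * unitPt t ∈ ball (0 : ℂ) 1 := fun t => by
    simp [norm_unitPt]; norm_num
  have hcoef : ∀ a : ℕ → Y, (∀ z ∈ ball (0 : ℂ) 1, HasSum (fun l => z ^ l • a l) (S z u)) →
      ∫ t in (0 : ℝ)..2 * Real.pi, (unitPt t ^ l)⁻¹ • S (((1 / 2 : ℝ) : ℂ) * unitPt t) u =
        (2 * Real.pi : ℂ) • (((1 / 2 : ℝ) : ℂ) ^ l • a l) := by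
    intro a ha
    refine integral_unitPt_smul_eq (a := fun l => ((1 / 2 : ℝ) : ℂ) ^ l • a l) ?_ (fun t => ?_) l
    · have := summable_pow_mul_norm (fun z hz => (ha z hz).summable)
        (r := 1 / 2) (by norm_num) (by norm_num)
      simpa [norm_smul] using this
    · simpa only [smul_smul, ← mul_pow, mul_comm (unitPt t)] using ha _ (hz t)
  have hpi : (2 * Real.pi : ℂ) ≠ 0 := by exact_mod_cast Real.two_pi_pos.ne'
  have := (hcoef _ hSu).symm.trans (hcoef _ hqS)
  rw [smul_right_injective _ hpi |>.eq_iff, smul_right_injective _ (pow_ne_zero l hr) |>.eq_iff]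
    at this
  rw [this, hq]
  exact Finset.Nat.sum_antidiagonal_eq_sum_range_succ (fun i n => (b i : ℂ) • (Fc n u) i) l

lemma sum_range_succ_sub_inv {β c : ℕ → ℝ} (hβ0 : β 0 = 1) (hc0 : c 0 = 1)
    (hcs : ∀ j, c (j + 1) = (β (j + 1))⁻¹ - (β j)⁻¹) (l : ℕ) :
    ∑ i ∈ Finset.range (l + 1), c i = (β l)⁻¹ := by
  induction l with
  | zero => simp [hc0, hβ0]
  | succ l ih => rw [Finset.sum_range_succ, ih, hcs, add_sub_cancel]

lemma sum_range_sum_range_convolution {M : Type*} [AddCommMonoid M] (a : ℕ → ℕ → ℕ → M) (l : ℕ) :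
    ∑ j ∈ Finset.range (l + 1), ∑ i ∈ Finset.range (j + 1), a i (j - i) (l - j) =
      ∑ i ∈ Finset.range (l + 1), ∑ n ∈ Finset.range (l - i + 1), a i n (l - i - n) := by
  rw [Finset.sum_sigma', Finset.sum_sigma']
  refine Finset.sum_nbij' (fun p => ⟨p.2, p.1 - p.2⟩) (fun p => ⟨p.1 + p.2, p.1⟩) ?_ ?_ ?_ ?_ ?_
  · rintro ⟨j, i⟩ h
    simp only [Finset.mem_sigma, Finset.mem_range] at h ⊢
    omega
  · rintro ⟨i, n⟩ h
    simp only [Finset.mem_sigma, Finset.mem_range] at h ⊢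
    omega
  · rintro ⟨j, i⟩ h
    simp only [Finset.mem_sigma, Finset.mem_range] at h
    simp only [Nat.add_sub_cancel' (Nat.lt_succ_iff.1 h.2)]
  · rintro ⟨i, n⟩ h
    simp only [Nat.add_sub_cancel_left]
  · rintro ⟨j, i⟩ h
    simp only [Finset.mem_sigma, Finset.mem_range] at h
    change a i (j - i) (l - j) = a i (j - i) (l - i - (j - i))
    congr 1
    omega

lemma norm_sum_sqrt_smul_sq_le {E : Type*} [NormedAddCommGroup E] [NormedSpace ℂ E]
    {c : ℕ → ℝ} (hc : ∀ j, 0 ≤ c j) (v : ℕ → E) (s : Finset ℕ) :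
    ‖∑ i ∈ s, (Real.sqrt (c i) : ℂ) • v i‖ ^ 2 ≤ (∑ i ∈ s, c i) * ∑ i ∈ s, ‖v i‖ ^ 2 := by
  calc ‖∑ i ∈ s, (Real.sqrt (c i) : ℂ) • v i‖ ^ 2
      ≤ (∑ i ∈ s, Real.sqrt (c i) * ‖v i‖) ^ 2 := by
        gcongr
        refine norm_sum_le_of_le _ fun i _ => ?_
        rw [norm_smul, Complex.norm_real, Real.norm_of_nonneg (Real.sqrt_nonneg _)]
    _ ≤ (∑ i ∈ s, Real.sqrt (c i) ^ 2) * ∑ i ∈ s, ‖v i‖ ^ 2 :=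
        Finset.sum_mul_sq_le_sq_mul_sq _ _ _
    _ = _ := by simp only [Real.sq_sqrt (hc _)]

lemma sum_norm_sq_diagonal_le {E : Type*} [NormedAddCommGroup E]
    (f : ℕ → lp (fun _ : ℕ => E) 2) (N : ℕ) :
    ∑ l ∈ Finset.range N, ∑ i ∈ Finset.range (l + 1), ‖f (l - i) i‖ ^ 2 ≤
      ∑ m ∈ Finset.range N, ‖f m‖ ^ 2 := by
  rw [Finset.sum_congr rfl fun l hl =>
    sum_range_succ_eq_sum_ite (fun i m => ‖f m i‖ ^ 2) (Finset.mem_range.1 hl), Finset.sum_comm]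
  refine Finset.sum_le_sum fun m _ => ?_
  refine sum_le_hasSum _ (fun l _ => ?_) ((lp_two_hasSum_norm_sq (f m)).shift m)
  split_ifs <;> positivity

theorem IsSchur.isContractiveMultiplier {U Y : Type*}
    [NormedAddCommGroup U] [InnerProductSpace ℂ U] [CompleteSpace U]
    [NormedAddCommGroup Y] [InnerProductSpace ℂ Y] [CompleteSpace Y]
    {β : ℕ → ℝ} (hβ : IsWeightSeq β) (hmono : ∀ j, β (j + 1) ≤ β j)
    {c : ℕ → ℝ} (hc0 : c 0 = 1) (hcs : ∀ j, c (j + 1) = (β (j + 1))⁻¹ - (β j)⁻¹)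
    {S : ℂ → (U →L[ℂ] Y)} {Sc : ℕ → (U →L[ℂ] Y)}
    (hTaylor : ∀ z ∈ ball (0 : ℂ) 1, HasSum (fun j => z ^ j • Sc j) (S z))
    {F : ℂ → (U →L[ℂ] lp (fun _ : ℕ => Y) 2)} (hF : IsSchur F)
    (hSF : ∀ z ∈ ball (0 : ℂ) 1, ∀ u : U,
      HasSum (fun j => ((Real.sqrt (c j) : ℂ) * z ^ j) • (F z u) j) (S z u)) :
    IsContractiveMultiplier β Sc := by
  intro h hh
  have hc := weight_diff_bounds hβ hmono hc0 hcs
  obtain ⟨Fc, hFc⟩ := hF.exists_hasSum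
  have hb : ∀ r : ℝ, 0 ≤ r → r < 1 → Summable fun j => r ^ j * Real.sqrt (c j) := by
    intro r hr0 hr1
    refine .of_nonneg_of_le (fun j => by positivity) (fun j => ?_)
      (hβ.summable_pow_div_sqrt hr0 hr1)
    rw [← Real.sqrt_inv]
    gcongr
    exact (hc j).2
  set f : ℕ → lp (fun _ : ℕ => Y) 2 := fun m => ∑ n ∈ Finset.range (m + 1), Fc n (h (m - n))
    with hf
  have hg : ∀ l, ∑ j ∈ Finset.range (l + 1), Sc j (h (l - j)) =
      ∑ i ∈ Finset.range (l + 1), (Real.sqrt (c i) : ℂ) • f (l - i) i := fun l => by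
    simp only [taylor_coeff_eq (fun j => Real.sqrt_nonneg (c j)) hb hTaylor hFc hSF]
    rw [sum_range_sum_range_convolution fun i n k => (Real.sqrt (c i) : ℂ) • (Fc n (h k)) i]
    refine Finset.sum_congr rfl fun i _ => ?_
    rw [hf, ← Finset.smul_sum]
    simp only [lp.coeFn_sum, Finset.sum_apply]
  have hle : ∀ l, β l * ‖∑ j ∈ Finset.range (l + 1), Sc j (h (l - j))‖ ^ 2 ≤
      ∑ i ∈ Finset.range (l + 1), ‖f (l - i) i‖ ^ 2 := fun l => by
    have := norm_sum_sqrt_smul_sq_le (fun j => (hc j).1) (fun i => f (l - i) i)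
      (Finset.range (l + 1))
    rw [sum_range_succ_sub_inv hβ.2.1 hc0 hcs, inv_mul_eq_div, le_div_iff₀' (hβ.1 l)] at this
    rwa [hg]
  have hN : ∀ N, ∑ l ∈ Finset.range N, β l * ‖∑ j ∈ Finset.range (l + 1), Sc j (h (l - j))‖ ^ 2 ≤
      ∑' k, ‖h k‖ ^ 2 := fun N =>
    calc _ ≤ ∑ l ∈ Finset.range N, ∑ i ∈ Finset.range (l + 1), ‖f (l - i) i‖ ^ 2 :=
          Finset.sum_le_sum fun l _ => hle l
      _ ≤ ∑ m ∈ Finset.range N, ‖f m‖ ^ 2 := sum_norm_sq_diagonal_le f N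
      _ ≤ ∑ m ∈ Finset.range N, ‖h m‖ ^ 2 := hF.sum_norm_sq_le hFc h N
      _ ≤ ∑' k, ‖h k‖ ^ 2 := hh.sum_le_tsum _ fun k _ => by positivity
  have h0 : ∀ l, 0 ≤ β l * ‖∑ j ∈ Finset.range (l + 1), Sc j (h (l - j))‖ ^ 2 := fun l =>
    mul_nonneg (hβ.1 l).le (by positivity)
  exact ⟨summable_of_sum_range_le h0 hN, Real.tsum_le_of_sum_range_le h0 hN⟩

theorem stmt1 {U Y : Type*}
    [NormedAddCommGroup U] [InnerProductSpace ℂ U] [CompleteSpace U]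
    [NormedAddCommGroup Y] [InnerProductSpace ℂ Y] [CompleteSpace Y]
    (β : ℕ → ℝ) (hβ : IsWeightSeq β) (hmono : ∀ j, β (j + 1) ≤ β j)
    (c : ℕ → ℝ) (hc0 : c 0 = 1) (hcs : ∀ j, c (j + 1) = (β (j + 1))⁻¹ - (β j)⁻¹)
    (S : ℂ → (U →L[ℂ] Y)) (Sc : ℕ → (U →L[ℂ] Y))
    (hTaylor : ∀ z ∈ ball (0 : ℂ) 1, HasSum (fun j => z ^ j • Sc j) (S z)) :
    IsContractiveMultiplier β Sc ↔
      ∃ F : ℂ → (U →L[ℂ] lp (fun _ : ℕ => Y) 2),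
        IsSchur F ∧
        -- `S z = Ψ_β z ∘ F z`, where `Ψ_β z : ℓ²(Y) → Y` maps `(y_j) ↦ Σ_j √(c_j) z^j y_j`
        ∀ z ∈ ball (0 : ℂ) 1, ∀ u : U,
          HasSum (fun j => ((Real.sqrt (c j) : ℂ) * z ^ j) • (F z u) j) (S z u) := by
  exact ⟨fun h => h.exists_isSchur hβ hmono hc0 hcs hTaylor,
    fun ⟨_, hF, hSF⟩ => hF.isContractiveMultiplier hβ hmono hc0 hcs hTaylor hSF⟩
end
end

section
/- Let β be a non-increasing weight sequence, U, Y complex Hilbert spaces, 𝐒 in the Schur class S(U, ℓ²(Y)), and define S(z) = Ψ_β(z) 𝐒(z) for z ∈ 𝔻. Then for all z, ζ ∈ 𝔻 one has the operator identity on Y: k_β(z, conj ζ)·I_Y − (1 − z·conj ζ)^{-1} S(z) S(ζ)* = Ψ_β(z) ∘ [ (1 − z·conj ζ)^{-1} (I_{ℓ²(Y)} − 𝐒(z) 𝐒(ζ)*) ] ∘ Ψ_β(ζ)*, where k_β(z, conj ζ) = Σ_{j≥0} β_j^{-1} z^j (conj ζ)^j. Consequently the kernel K_S(z,ζ) = k_β(z,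 conj ζ)·I_Y − (1 − z·conj ζ)^{-1} S(z) S(ζ)* is positive on 𝔻 × 𝔻: for all z_1,…,z_m ∈ 𝔻 and y_1,…,y_m ∈ Y, Σ_{i,l=1}^{m} ⟨K_S(z_i, z_l) y_l, y_i⟩ ≥ 0. -/
open Metric Filter

noncomputable section

/-- The finite combination of Szegő kernels of the disk of radius `r` with nodes `z l` and
coefficients `x l`. -/
def szegoSum {ι E : Type*} [Fintype ι] [NormedAddCommGroup E] [NormedSpace ℂ E]
    (r : ℝ) (z : ι → ℂ) (x : ι → E) (w : ℂ) : E :=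
  ∑ l, ((r : ℂ) ^ 2 / ((r : ℂ) ^ 2 - w * starRingEnd ℂ (z l))) • x l

theorem szego_denom_ne_zero {r : ℝ} {z w : ℂ} (hz : ‖z‖ < r) (hw : ‖w‖ ≤ r) :
    (r : ℂ) ^ 2 - w * starRingEnd ℂ z ≠ 0 := by
  have hr : 0 < r := (norm_nonneg z).trans_lt hz
  intro h
  have h1 : ‖(r : ℂ) ^ 2‖ = ‖w * starRingEnd ℂ z‖ := by rw [sub_eq_zero.1 h]
  rw [norm_pow, norm_mul, RCLike.norm_conj, Complex.norm_real, Real.norm_of_nonneg hr.le] at h1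
  nlinarith [norm_nonneg z, norm_nonneg w]

theorem differentiableOn_szegoSum {ι E : Type*} [Fintype ι] [NormedAddCommGroup E]
    [NormedSpace ℂ E] {r : ℝ} {z : ι → ℂ} (hz : ∀ i, ‖z i‖ < r) (x : ι → E) :
    DifferentiableOn ℂ (szegoSum r z x) (closedBall 0 r) := by
  unfold szegoSum
  refine DifferentiableOn.fun_sum fun l _ => DifferentiableOn.smul_const ?_ _
  refine DifferentiableOn.div (by fun_prop) (by fun_prop) fun w hw => ?_
  exact szego_denom_ne_zero (hz l) (by simpa using hw)

/-- Reproducing property of the Szegő kernel on a circle. -/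
theorem circleAverage_inner_szegoSum {ι E : Type*} [Fintype ι] [NormedAddCommGroup E]
    [InnerProductSpace ℂ E] {r : ℝ} (hr : 0 < r) {z : ι → ℂ} (hz : ∀ i, ‖z i‖ < r) (x : ι → E)
    {h : ℂ → E} (hh : DifferentiableOn ℂ h (closedBall 0 r)) :
    Real.circleAverage (fun w => inner ℂ (szegoSum r z x w) (h w)) 0 r
      = ∑ i, inner ℂ (x i) (h (z i)) := by
  have hd : ∀ i, DifferentiableOn ℂ (fun w => inner ℂ (x i) (h w)) (closedBall 0 r) := fun i =>
    (innerSL ℂ (x i)).differentiable.comp_differentiableOn hh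
  have hne : ∀ i, ∀ w ∈ sphere (0 : ℂ) |r|, w - z i ≠ 0 := fun i w hw h0 => by
    have := hz i
    rw [← sub_eq_zero.1 h0] at this
    simp [abs_of_pos hr] at hw
    linarith
  have heq : Set.EqOn (fun w => inner ℂ (szegoSum r z x w) (h w))
      (fun w => ∑ i, ((w - 0) / (w - z i)) • inner ℂ (x i) (h w)) (sphere 0 |r|) := by
    intro w hw
    have hwr : ‖w‖ = r := by simpa [abs_of_pos hr] using hw
    have hw2 : (r : ℂ) ^ 2 = w * starRingEnd ℂ w := by
      rw [Complex.mul_conj, Complex.normSq_eq_norm_sq, hwr]; push_cast; rfl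
    have hcw : starRingEnd ℂ w ≠ 0 := by
      rw [Ne, map_eq_zero]; rintro rfl; simp at hwr; linarith
    simp only [szegoSum, sum_inner, inner_smul_left, smul_eq_mul]
    refine Finset.sum_congr rfl fun i _ => ?_
    congr 1
    simp only [map_div₀, map_sub, map_mul, map_pow, Complex.conj_ofReal, Complex.conj_conj]
    rw [hw2, sub_zero, show w * starRingEnd ℂ w - starRingEnd ℂ w * z i
      = starRingEnd ℂ w * (w - z i) by ring, mul_comm w, mul_div_mul_left _ _ hcw]
  rw [Real.circleAverage_congr_sphere heq, Real.circleAverage_fun_sum]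
  · refine Finset.sum_congr rfl fun i _ => ?_
    refine DiffContOnCl.circleAverage_smul_div (f := fun w => inner ℂ (x i) (h w)) ?_ ?_
    · refine DifferentiableOn.diffContOnCl ?_
      rw [abs_of_pos hr, closure_ball _ hr.ne']
      exact hd i
    · simpa [abs_of_pos hr] using hz i
  · intro i _
    refine ContinuousOn.circleIntegrable' ?_
    refine ContinuousOn.smul (ContinuousOn.div (by fun_prop) (by fun_prop) (hne i)) ?_
    refine (hd i).continuousOn.mono ?_
    rw [abs_of_pos hr]
    exact sphere_subset_closedBall

theorem circleAverage_inner_self {E : Type*} [NormedAddCommGroup E] [InnerProductSpace ℂ E]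
    {r : ℝ} {g : ℂ → E} (hg : CircleIntegrable (fun w => ‖g w‖ ^ 2) 0 r) :
    Real.circleAverage (fun w => inner ℂ (g w) (g w)) 0 r
      = ((Real.circleAverage (fun w => ‖g w‖ ^ 2) 0 r : ℝ) : ℂ) := by
  have := Complex.ofRealCLM.circleAverage_comp_comm hg
  simp only [Function.comp_def, Complex.ofRealCLM_apply] at this
  rw [← this]
  congr 1
  ext w
  rw [inner_self_eq_norm_sq_to_K]
  norm_cast

open scoped ComplexOrder in
/-- Positivity of the de Branges–Rovnyak kernel on a disk of radius `r < 1`. -/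
theorem schur_kernel_nonneg_radius {ι U V : Type*} [Fintype ι]
    [NormedAddCommGroup U] [InnerProductSpace ℂ U] [CompleteSpace U]
    [NormedAddCommGroup V] [InnerProductSpace ℂ V] [CompleteSpace V]
    {F : ℂ → U →L[ℂ] V} (hF : IsSchur F) {r : ℝ} (hr : 0 < r) (hr1 : r < 1)
    {z : ι → ℂ} (hz : ∀ i, ‖z i‖ < r) (x : ι → V) :
    0 ≤ ∑ i, ∑ l, ((r : ℂ) ^ 2 / ((r : ℂ) ^ 2 - z i * starRingEnd ℂ (z l))) *
      inner ℂ (x i) (x l - F (z i) (ContinuousLinearMap.adjoint (F (z l)) (x l))) := by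
  have hFd : DifferentiableOn ℂ F (closedBall 0 r) :=
    hF.1.differentiableOn.mono (closedBall_subset_ball hr1)
  set a : ι → U := fun l => ContinuousLinearMap.adjoint (F (z l)) (x l) with ha
  set k := szegoSum r z x with hk
  set g := szegoSum r z a with hg
  have kd : DifferentiableOn ℂ k (closedBall 0 r) := differentiableOn_szegoSum hz x
  have gd : DifferentiableOn ℂ g (closedBall 0 r) := differentiableOn_szegoSum hz a
  have Fgd : DifferentiableOn ℂ (fun w => F w (g w)) (closedBall 0 r) := hFd.clm_apply gd
  have hsub : sphere (0 : ℂ) |r| ⊆ closedBall 0 r := by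
    rw [abs_of_pos hr]; exact sphere_subset_closedBall
  have ki : CircleIntegrable (fun w => ‖k w‖ ^ 2) 0 r :=
    ContinuousOn.circleIntegrable' ((kd.continuousOn.mono hsub).norm.pow 2)
  have gi : CircleIntegrable (fun w => ‖g w‖ ^ 2) 0 r :=
    ContinuousOn.circleIntegrable' ((gd.continuousOn.mono hsub).norm.pow 2)
  have kFi : CircleIntegrable (fun w => inner ℂ (k w) (F w (g w))) 0 r :=
    ContinuousOn.circleIntegrable'
      ((kd.continuousOn.mono hsub).inner (Fgd.continuousOn.mono hsub))
  have e1 := circleAverage_inner_szegoSum hr hz x kd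
  have e2 := circleAverage_inner_szegoSum hr hz a gd
  have e3 := circleAverage_inner_szegoSum hr hz x Fgd
  have e4 : ∑ i, inner ℂ (x i) (F (z i) (g (z i))) = ∑ i, inner ℂ (a i) (g (z i)) :=
    Finset.sum_congr rfl fun i _ => (ContinuousLinearMap.adjoint_inner_left _ _ _).symm
  rw [e4, ← e2, ← hk, ← hg, circleAverage_inner_self gi] at e3
  have e5 := Complex.reCLM.circleAverage_comp_comm kFi
  rw [e3] at e5
  simp only [Function.comp_def, Complex.reCLM_apply, Complex.ofReal_re] at e5
  have hle : Real.circleAverage (fun w => (inner ℂ (k w) (F w (g w))).re) 0 r ≤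
      Real.circleAverage (fun w => (1 / 2 : ℝ) • (‖k w‖ ^ 2 + ‖g w‖ ^ 2)) 0 r := by
    refine Real.circleAverage_mono ?_ ?_ ?_
    · exact ContinuousOn.circleIntegrable' (Complex.continuous_re.comp_continuousOn
        ((kd.continuousOn.mono hsub).inner (Fgd.continuousOn.mono hsub)))
    · have hkc := kd.continuousOn.mono hsub
      have hgc := gd.continuousOn.mono hsub
      exact ContinuousOn.circleIntegrable' (by fun_prop)
    · intro w hw
      have hw1 : w ∈ ball (0 : ℂ) 1 := closedBall_subset_ball hr1 (hsub hw)
      have h1 : (inner ℂ (k w) (F w (g w))).re ≤ ‖k w‖ * ‖F w (g w)‖ :=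
        (Complex.re_le_norm _).trans (norm_inner_le_norm _ _)
      have h2 : ‖F w (g w)‖ ≤ ‖g w‖ :=
        ((F w).le_of_opNorm_le (hF.2 w hw1) _).trans_eq (one_mul _)
      have h3 := mul_le_mul_of_nonneg_left h2 (norm_nonneg (k w))
      simp only [smul_eq_mul]
      nlinarith [sq_nonneg (‖k w‖ - ‖g w‖)]
  rw [e5, Real.circleAverage_fun_smul, Real.circleAverage_fun_add ki gi, smul_eq_mul] at hle
  have hsum : ∑ i, ∑ l, ((r : ℂ) ^ 2 / ((r : ℂ) ^ 2 - z i * starRingEnd ℂ (z l))) *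
      inner ℂ (x i) (x l - F (z i) (a l))
      = ∑ i, inner ℂ (x i) (k (z i)) - ∑ i, inner ℂ (a i) (g (z i)) := by
    rw [← e4, ← Finset.sum_sub_distrib]
    refine Finset.sum_congr rfl fun i _ => ?_
    simp only [hk, hg, szegoSum, map_sum, inner_sum, ← Finset.sum_sub_distrib, map_smul,
      inner_smul_right, inner_sub_right, mul_sub]
  rw [hsum, ← e1, ← e2, ← hk, ← hg, circleAverage_inner_self ki, circleAverage_inner_self gi,
    ← Complex.ofReal_sub]
  rw [Complex.zero_le_real]
  linarith

open scoped ComplexOrder in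
/-- Positivity of the de Branges–Rovnyak kernel of a Schur class function. -/
theorem schur_kernel_nonneg {ι U V : Type*} [Fintype ι]
    [NormedAddCommGroup U] [InnerProductSpace ℂ U] [CompleteSpace U]
    [NormedAddCommGroup V] [InnerProductSpace ℂ V] [CompleteSpace V]
    {F : ℂ → U →L[ℂ] V} (hF : IsSchur F)
    {z : ι → ℂ} (hz : ∀ i, z i ∈ ball (0 : ℂ) 1) (x : ι → V) :
    0 ≤ ∑ i, ∑ l, (1 - z i * starRingEnd ℂ (z l))⁻¹ *
      inner ℂ (x i) (x l - F (z i) (ContinuousLinearMap.adjoint (F (z l)) (x l))) := by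
  have hz1 : ∀ i, ‖z i‖ < 1 := fun i => by simpa using hz i
  have hlim : Tendsto (fun r : ℝ => ∑ i, ∑ l,
      ((r : ℂ) ^ 2 / ((r : ℂ) ^ 2 - z i * starRingEnd ℂ (z l))) *
      inner ℂ (x i) (x l - F (z i) (ContinuousLinearMap.adjoint (F (z l)) (x l))))
      (nhdsWithin 1 (Set.Iio 1)) (nhds (∑ i, ∑ l, (1 - z i * starRingEnd ℂ (z l))⁻¹ *
      inner ℂ (x i) (x l - F (z i) (ContinuousLinearMap.adjoint (F (z l)) (x l))))) := by
    refine tendsto_finsetSum _ fun i _ => tendsto_finsetSum _ fun l _ =>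
      Tendsto.mul_const _ ?_
    have hc : ContinuousAt (fun r : ℝ =>
        (r : ℂ) ^ 2 / ((r : ℂ) ^ 2 - z i * starRingEnd ℂ (z l))) 1 := by
      refine ContinuousAt.div (by fun_prop) (by fun_prop) ?_
      exact szego_denom_ne_zero (hz1 l) (hz1 i).le
    have := hc.tendsto.mono_left (nhdsWithin_le_nhds (s := Set.Iio 1))
    simpa using this
  refine ge_of_tendsto hlim ?_
  have hev : ∀ i, ∀ᶠ r in nhdsWithin (1 : ℝ) (Set.Iio 1), ‖z i‖ < r := fun i =>
    (lt_mem_nhds (hz1 i)).filter_mono nhdsWithin_le_nhds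
  filter_upwards [eventually_all.2 hev, self_mem_nhdsWithin,
    (lt_mem_nhds (zero_lt_one (α := ℝ))).filter_mono nhdsWithin_le_nhds] with r h1 h2 h3
  exact schur_kernel_nonneg_radius hF h3 h2 h1 x

theorem summable_inv_weight_mul_pow {β : ℕ → ℝ} (hβ : IsWeightSeq β) {w : ℂ} (hw : ‖w‖ < 1) :
    Summable fun j => ((β j)⁻¹ : ℂ) * w ^ j := by
  obtain ⟨hpos, -, hlim⟩ := hβ
  obtain ⟨r, hwr, hr1⟩ := exists_between hw
  have hr0 : 0 < r := (norm_nonneg w).trans_lt hwr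
  have hev : ∀ᶠ j : ℕ in atTop, r < β j ^ ((1 : ℝ) / j) :=
    eventually_lt_of_lt_liminf (hr1.trans_le hlim)
      (isBoundedUnder_of_eventually_ge (a := 0)
        (Eventually.of_forall fun j => Real.rpow_nonneg (hpos j).le _))
  have hgeo : Summable fun j : ℕ => (‖w‖ / r) ^ j :=
    summable_geometric_of_lt_one (by positivity) ((div_lt_one hr0).2 hwr)
  refine Summable.of_norm_bounded_eventually_nat hgeo ?_
  filter_upwards [hev, eventually_gt_atTop 0] with j hj hj0
  have hrj : r ^ j ≤ β j := by
    have := pow_le_pow_left₀ hr0.le hj.le j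
    rwa [one_div, Real.rpow_inv_natCast_pow (hpos j).le hj0.ne'] at this
  rw [norm_mul, norm_inv, Complex.norm_real, norm_pow, Real.norm_of_nonneg (hpos j).le, div_pow,
    div_eq_inv_mul]
  gcongr

theorem hasSum_weight_diff_mul_pow {β : ℕ → ℝ} (hβ : IsWeightSeq β) {c : ℕ → ℝ} (hc0 : c 0 = 1)
    (hcs : ∀ j, c (j + 1) = (β (j + 1))⁻¹ - (β j)⁻¹) {w : ℂ} (hw : ‖w‖ < 1) :
    HasSum (fun j => (c j : ℂ) * w ^ j) ((1 - w) * ∑' j, ((β j)⁻¹ : ℂ) * w ^ j) := by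
  have hs := (summable_inv_weight_mul_pow hβ hw).hasSum
  rw [← hasSum_nat_add_iff' 1]
  have h1 := ((hasSum_nat_add_iff' 1).2 hs).sub (hs.mul_left w)
  convert h1 using 1
  · ext j
    rw [hcs]
    push_cast
    ring
  · simp [hc0, hβ.2.1]
    ring

theorem weight_diff_nonneg {β : ℕ → ℝ} (hpos : ∀ j, 0 < β j) (hmono : ∀ j, β (j + 1) ≤ β j)
    {c : ℕ → ℝ} (hc0 : c 0 = 1) (hcs : ∀ j, c (j + 1) = (β (j + 1))⁻¹ - (β j)⁻¹) (j : ℕ) :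
    0 ≤ c j := by
  cases j with
  | zero => simp [hc0]
  | succ j => rw [hcs, sub_nonneg]; exact inv_anti₀ (hpos _) (hmono j)

theorem norm_mul_conj_lt_one {z ζ : ℂ} (hz : ‖z‖ < 1) (hζ : ‖ζ‖ < 1) :
    ‖z * starRingEnd ℂ ζ‖ < 1 := by
  rw [norm_mul, RCLike.norm_conj]
  exact mul_lt_one_of_nonneg_of_lt_one_left (norm_nonneg z) hz hζ.le

theorem sqrt_mul_pow_mul_conj {c : ℝ} (hc : 0 ≤ c) (z ζ : ℂ) (j : ℕ) :
    ((Real.sqrt c : ℂ) * z ^ j) * starRingEnd ℂ ((Real.sqrt c : ℂ) * ζ ^ j)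
      = (c : ℂ) * (z * starRingEnd ℂ ζ) ^ j := by
  have h : (Real.sqrt c : ℂ) * Real.sqrt c = c := by
    rw [← Complex.ofReal_mul, Real.mul_self_sqrt hc]
  simp only [map_mul, map_pow, Complex.conj_ofReal, mul_pow]
  rw [← h]
  ring

/-- If `S = Ψ ∘ F` where `Ψ` sums a sequence against the coefficients `a`, and `f = Ψ* y`, then
`S* y = F* f`. -/
theorem adjoint_apply_of_hasSum {U Y : Type*}
    [NormedAddCommGroup U] [InnerProductSpace ℂ U] [CompleteSpace U]
    [NormedAddCommGroup Y] [InnerProductSpace ℂ Y] [CompleteSpace Y]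
    {F : U →L[ℂ] lp (fun _ : ℕ => Y) 2} {S : U →L[ℂ] Y} {a : ℕ → ℂ}
    (hS : ∀ u, HasSum (fun j => a j • (F u) j) (S u)) {y : Y} {f : lp (fun _ : ℕ => Y) 2}
    (hf : ∀ j, f j = starRingEnd ℂ (a j) • y) :
    ContinuousLinearMap.adjoint S y = ContinuousLinearMap.adjoint F f := by
  refine ext_inner_right ℂ fun u => ?_
  rw [ContinuousLinearMap.adjoint_inner_left, ContinuousLinearMap.adjoint_inner_left]
  refine ((hS u).mapL (innerSL ℂ y)).unique ?_
  convert lp.hasSum_inner (𝕜 := ℂ) f (F u) using 1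
  ext j
  simp [hf, inner_smul_left]

theorem exists_lp_weight {Y : Type*} [NormedAddCommGroup Y] [InnerProductSpace ℂ Y]
    {β : ℕ → ℝ} (hβ : IsWeightSeq β) (hmono : ∀ j, β (j + 1) ≤ β j) {c : ℕ → ℝ} (hc0 : c 0 = 1)
    (hcs : ∀ j, c (j + 1) = (β (j + 1))⁻¹ - (β j)⁻¹) {ζ : ℂ} (hζ : ‖ζ‖ < 1) (y : Y) :
    ∃ f : lp (fun _ : ℕ => Y) 2,
      ∀ j, f j = (starRingEnd ℂ ((Real.sqrt (c j) : ℂ) * ζ ^ j)) • y := by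
  refine ⟨⟨fun j => (starRingEnd ℂ ((Real.sqrt (c j) : ℂ) * ζ ^ j)) • y, memℓp_gen ?_⟩,
    fun j => rfl⟩
  have hs := (hasSum_weight_diff_mul_pow hβ hc0 hcs
    (norm_mul_conj_lt_one hζ hζ)).summable.norm.mul_right (‖y‖ ^ 2)
  refine hs.congr fun j => ?_
  rw [← sqrt_mul_pow_mul_conj (weight_diff_nonneg hβ.1 hmono hc0 hcs j), ENNReal.toReal_ofNat,
    Real.rpow_ofNat, norm_smul, norm_mul _ (starRingEnd ℂ _), RCLike.norm_conj]
  ring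

theorem stmt2 {U Y : Type*}
    [NormedAddCommGroup U] [InnerProductSpace ℂ U] [CompleteSpace U]
    [NormedAddCommGroup Y] [InnerProductSpace ℂ Y] [CompleteSpace Y]
    (β : ℕ → ℝ) (hβ : IsWeightSeq β) (hmono : ∀ j, β (j + 1) ≤ β j)
    (c : ℕ → ℝ) (hc0 : c 0 = 1) (hcs : ∀ j, c (j + 1) = (β (j + 1))⁻¹ - (β j)⁻¹)
    (F : ℂ → (U →L[ℂ] lp (fun _ : ℕ => Y) 2)) (hF : IsSchur F)
    -- `S z = Ψ_β z ∘ F z`, where `Ψ_β z : ℓ²(Y) → Y` maps `(y_j) ↦ Σ_j √(c_j) z^j y_j`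
    (S : ℂ → (U →L[ℂ] Y))
    (hS : ∀ z ∈ ball (0 : ℂ) 1, ∀ u : U,
      HasSum (fun j => ((Real.sqrt (c j) : ℂ) * z ^ j) • (F z u) j) (S z u)) :
    -- the operator identity, stated applied to an arbitrary `y' : Y`;
    -- here `f = Ψ_β(ζ)* y'` is the element of `ℓ²(Y)` with entries `conj(√(c_j) ζ^j) • y'`
    (∀ z ∈ ball (0 : ℂ) 1, ∀ ζ ∈ ball (0 : ℂ) 1, ∀ y' : Y,
      ∀ f : lp (fun _ : ℕ => Y) 2,
        (∀ j, f j = (starRingEnd ℂ ((Real.sqrt (c j) : ℂ) * ζ ^ j)) • y') →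
        (∑' j, (((β j)⁻¹ : ℝ) : ℂ) * z ^ j * (starRingEnd ℂ ζ) ^ j) • y'
            - (1 - z * starRingEnd ℂ ζ)⁻¹ •
                S z (ContinuousLinearMap.adjoint (S ζ) y')
          = (1 - z * starRingEnd ℂ ζ)⁻¹ •
              ∑' j, ((Real.sqrt (c j) : ℂ) * z ^ j) •
                ((f - F z (ContinuousLinearMap.adjoint (F ζ) f)) j)) ∧
    -- consequently, the kernel `K_S` is positive on 𝔻 × 𝔻
    (∀ (m : ℕ) (zs : Fin m → ℂ), (∀ i, zs i ∈ ball (0 : ℂ) 1) → ∀ y : Fin m → Y,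
      0 ≤ (∑ i, ∑ l, inner (𝕜 := ℂ) (y i)
            ((∑' j, (((β j)⁻¹ : ℝ) : ℂ) * (zs i) ^ j * (starRingEnd ℂ (zs l)) ^ j) • y l
              - (1 - zs i * starRingEnd ℂ (zs l))⁻¹ •
                  S (zs i) (ContinuousLinearMap.adjoint (S (zs l)) (y l)))).re ∧
      (∑ i, ∑ l, inner (𝕜 := ℂ) (y i)
            ((∑' j, (((β j)⁻¹ : ℝ) : ℂ) * (zs i) ^ j * (starRingEnd ℂ (zs l)) ^ j) • y l
              - (1 - zs i * starRingEnd ℂ (zs l))⁻¹ •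
                  S (zs i) (ContinuousLinearMap.adjoint (S (zs l)) (y l)))).im = 0) := by
  have hnorm : ∀ {z : ℂ}, z ∈ ball (0 : ℂ) 1 → ‖z‖ < 1 := fun h => by simpa using h
  have hne : ∀ z ∈ ball (0 : ℂ) 1, ∀ ζ ∈ ball (0 : ℂ) 1, 1 - z * starRingEnd ℂ ζ ≠ 0 :=
    fun z hz ζ hζ h => by
      have hw := norm_mul_conj_lt_one (hnorm hz) (hnorm hζ)
      rw [← sub_eq_zero.1 h] at hw; simp at hw
  have key : ∀ z ∈ ball (0 : ℂ) 1, ∀ ζ ∈ ball (0 : ℂ) 1, ∀ y' : Y,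
      ∀ f : lp (fun _ : ℕ => Y) 2,
        (∀ j, f j = (starRingEnd ℂ ((Real.sqrt (c j) : ℂ) * ζ ^ j)) • y') →
        HasSum (fun j => ((Real.sqrt (c j) : ℂ) * z ^ j) •
          ((f - F z (ContinuousLinearMap.adjoint (F ζ) f)) j))
        ((1 - z * starRingEnd ℂ ζ) •
          ((∑' j, (((β j)⁻¹ : ℝ) : ℂ) * z ^ j * (starRingEnd ℂ ζ) ^ j) • y'
            - (1 - z * starRingEnd ℂ ζ)⁻¹ •
                S z (ContinuousLinearMap.adjoint (S ζ) y'))) := by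
    intro z hz ζ hζ y' f hf
    have hw := norm_mul_conj_lt_one (hnorm hz) (hnorm hζ)
    have h1 := (hasSum_weight_diff_mul_pow hβ hc0 hcs hw).smul_const y'
    have h2 := hS z hz (ContinuousLinearMap.adjoint (F ζ) f)
    rw [adjoint_apply_of_hasSum (hS ζ hζ) hf, smul_sub, smul_inv_smul₀ (hne z hz ζ hζ), smul_smul]
    convert h1.sub h2 using 1
    · ext j
      rw [lp.coeFn_sub, Pi.sub_apply, smul_sub, hf, smul_smul,
        sqrt_mul_pow_mul_conj (weight_diff_nonneg hβ.1 hmono hc0 hcs j)]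
    · simp only [mul_pow, mul_assoc, Complex.ofReal_inv]
  refine ⟨fun z hz ζ hζ y' f hf => ?_, fun m zs hzs y => ?_⟩
  · rw [(key z hz ζ hζ y' f hf).tsum_eq, inv_smul_smul₀ (hne z hz ζ hζ)]
  · choose f hf using fun i => exists_lp_weight hβ hmono hc0 hcs (hnorm (hzs i)) (y i)
    have hpos := schur_kernel_nonneg hF hzs f
    rw [Complex.nonneg_iff] at hpos
    have heq : (∑ i, ∑ l, inner (𝕜 := ℂ) (y i)
            ((∑' j, (((β j)⁻¹ : ℝ) : ℂ) * (zs i) ^ j * (starRingEnd ℂ (zs l)) ^ j) • y l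
              - (1 - zs i * starRingEnd ℂ (zs l))⁻¹ •
                  S (zs i) (ContinuousLinearMap.adjoint (S (zs l)) (y l))))
        = ∑ i, ∑ l, (1 - zs i * starRingEnd ℂ (zs l))⁻¹ * inner ℂ (f i)
            (f l - F (zs i) (ContinuousLinearMap.adjoint (F (zs l)) (f l))) := by
      refine Finset.sum_congr rfl fun i _ => Finset.sum_congr rfl fun l _ => ?_
      have h1 := (key _ (hzs i) _ (hzs l) _ _ (hf l)).mapL (innerSL ℂ (y i))
      have h2 := lp.hasSum_inner (𝕜 := ℂ) (f i)
        (f l - F (zs i) (ContinuousLinearMap.adjoint (F (zs l)) (f l)))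
      have h3 := h1.unique (h2.congr_fun fun j => by
        simp [hf i, inner_smul_left])
      rw [← h3, innerSL_apply_apply, inner_smul_right,
        inv_mul_cancel_left₀ (hne _ (hzs i) _ (hzs l))]
    rw [heq]
    exact ⟨hpos.1, hpos.2.symm⟩
end
end

section
/- Let β be a weight sequence, let X, U, Y be complex Hilbert spaces, T ∈ L(X), E ∈ L(X,Y), N ∈ L(X,U). Assume the pair (E,T) is β-output stable and that S : 𝔻 → L(U,Y) is a contractive multiplier from H²(U) to H²_β(Y), with Taylor coefficients (S_j), satisfying the interpolation condition (E*S)^{∧L}(T*) = N*. Then: (a) the pair (N,T) is 1-output stable; (b) for every sequence (h_k)_{k≥0} in U with Σ_k ‖h_k‖² < ∞ and every x ∈ X, the series Σ_{ℓ≥0} ⟨g_ℓ, E T^ℓ x⟩_Y (where g_ℓ = Σ_{j=0}^{ℓ} S_j h_{ℓ−j}) and Σ_{k≥0} ⟨h_k, N T^k x⟩_U both converge and are equal; (c) for every x ∈ X, Σ_{j≥0} ‖N T^j x‖² − Σ_{j≥0} ‖N T^{j+1} x‖² = ‖N x‖². -/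
open Metric Filter

noncomputable section

/-- The pair `(E,T)` is `β`-output stable:
`Σ_j β_j⁻¹ ‖E T^j x‖² ≤ C ‖x‖²` for some `C ≥ 0` and all `x`. -/
def OutputStable {X Y : Type*} [NormedAddCommGroup X] [InnerProductSpace ℂ X]
    [NormedAddCommGroup Y] [InnerProductSpace ℂ Y]
    (β : ℕ → ℝ) (E : X →L[ℂ] Y) (T : X →L[ℂ] X) : Prop :=
  ∃ C : ℝ, 0 ≤ C ∧ ∀ x : X,
    Summable (fun j => (β j)⁻¹ * ‖E ((T ^ j) x)‖ ^ 2) ∧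
    ∑' j, (β j)⁻¹ * ‖E ((T ^ j) x)‖ ^ 2 ≤ C * ‖x‖ ^ 2

/-- Cauchy–Schwarz for series of inner products, with a positive weight. -/
theorem summable_inner_and_norm_tsum_sq_le {ι Y : Type*} [NormedAddCommGroup Y]
    [InnerProductSpace ℂ Y] {w : ι → ℝ} (hw : ∀ i, 0 < w i) {a b : ι → Y}
    (ha : Summable fun i => (w i)⁻¹ * ‖a i‖ ^ 2) (hb : Summable fun i => w i * ‖b i‖ ^ 2) :
    Summable (fun i => inner (𝕜 := ℂ) (a i) (b i)) ∧
      ‖∑' i, inner (𝕜 := ℂ) (a i) (b i)‖ ^ 2 ≤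
        (∑' i, (w i)⁻¹ * ‖a i‖ ^ 2) * ∑' i, w i * ‖b i‖ ^ 2 := by
  have ha0 : ∀ i, 0 ≤ (w i)⁻¹ * ‖a i‖ ^ 2 := fun i => by have := hw i; positivity
  have hb0 : ∀ i, 0 ≤ w i * ‖b i‖ ^ 2 := fun i => by have := hw i; positivity
  have hsq : ∀ i, ‖inner (𝕜 := ℂ) (a i) (b i)‖ ^ 2 ≤
      (w i)⁻¹ * ‖a i‖ ^ 2 * (w i * ‖b i‖ ^ 2) := fun i => by
    have h1 := pow_le_pow_left₀ (norm_nonneg _) (norm_inner_le_norm (𝕜 := ℂ) (a i) (b i)) 2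
    have h2 : (w i)⁻¹ * ‖a i‖ ^ 2 * (w i * ‖b i‖ ^ 2) = (‖a i‖ * ‖b i‖) ^ 2 := by
      have := (hw i).ne'
      field_simp
    rwa [h2]
  have hsum : Summable fun i => inner (𝕜 := ℂ) (a i) (b i) := by
    refine Summable.of_norm_bounded (ha.add hb) fun i => ?_
    refine abs_le_of_sq_le_sq' ?_ (add_nonneg (ha0 i) (hb0 i)) |>.2
    nlinarith [hsq i, ha0 i, hb0 i, mul_nonneg (ha0 i) (hb0 i)]
  refine ⟨hsum, le_of_tendsto (hsum.hasSum.norm.pow 2) (Eventually.of_forall fun s => ?_)⟩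
  calc ‖∑ i ∈ s, inner (𝕜 := ℂ) (a i) (b i)‖ ^ 2
      ≤ (∑ i ∈ s, ‖inner (𝕜 := ℂ) (a i) (b i)‖) ^ 2 := by
        gcongr
        exact norm_sum_le _ _
    _ ≤ (∑ i ∈ s, (w i)⁻¹ * ‖a i‖ ^ 2) * ∑ i ∈ s, w i * ‖b i‖ ^ 2 :=
        Finset.sum_sq_le_sum_mul_sum_of_sq_le_mul s (fun i _ => ha0 i) (fun i _ => hb0 i)
          fun i _ => hsq i
    _ ≤ _ := mul_le_mul (ha.sum_le_tsum s fun i _ => ha0 i) (hb.sum_le_tsum s fun i _ => hb0 i)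
        (Finset.sum_nonneg fun i _ => hb0 i) (tsum_nonneg ha0)

/-- The Cauchy product of an operator sequence with a finitely supported vector sequence. -/
theorem sum_range_apply_indicator {U Y : Type*} [NormedAddCommGroup U] [InnerProductSpace ℂ U]
    [NormedAddCommGroup Y] [InnerProductSpace ℂ Y] (A : ℕ → (U →L[ℂ] Y)) (h : ℕ → U)
    (s : Finset ℕ) (l : ℕ) :
    ∑ j ∈ Finset.range (l + 1), A j ((s : Set ℕ).indicator h (l - j)) =
      ∑ k ∈ s, if k ≤ l then A (l - k) (h k) else 0 := by
  classical
  rw [← Finset.sum_flip, ← Finset.sum_filter]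
  have hsub : s.filter (· ≤ l) ⊆ Finset.range (l + 1) := fun k hk => by
    have := (Finset.mem_filter.1 hk).2
    exact Finset.mem_range.2 (by omega)
  symm
  refine Finset.sum_subset_zero_on_sdiff hsub (fun k hk => ?_) (fun k hk => ?_)
  · have hkl : k ≤ l := Nat.lt_succ_iff.1 (Finset.mem_range.1 (Finset.mem_sdiff.1 hk).1)
    have hks : k ∉ s := fun hks =>
      (Finset.mem_sdiff.1 hk).2 (Finset.mem_filter.2 ⟨hks, hkl⟩)
    simp [Nat.sub_sub_self hkl, hks]
  · have hkl := (Finset.mem_filter.1 hk).2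
    have hks := (Finset.mem_filter.1 hk).1
    simp [Nat.sub_sub_self hkl, hks]

theorem hasSum_norm_sq_indicator {U : Type*} [NormedAddCommGroup U] (h : ℕ → U) (s : Finset ℕ) :
    HasSum (fun k => ‖(s : Set ℕ).indicator h k‖ ^ 2) (∑ k ∈ s, ‖h k‖ ^ 2) := by
  have hsum : ∑ k ∈ s, ‖(s : Set ℕ).indicator h k‖ ^ 2 = ∑ k ∈ s, ‖h k‖ ^ 2 :=
    Finset.sum_congr rfl fun k hk => by simp [hk]
  exact hsum ▸ hasSum_sum_of_ne_finset_zero fun k hk => by simp [hk]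

section Interpolation

variable {X U Y : Type*} [NormedAddCommGroup X] [InnerProductSpace ℂ X]
  [NormedAddCommGroup U] [InnerProductSpace ℂ U] [NormedAddCommGroup Y] [InnerProductSpace ℂ Y]
  {T : X →L[ℂ] X} {E : X →L[ℂ] Y} {N : X →L[ℂ] U} {Sc : ℕ → (U →L[ℂ] Y)}

/-- The interpolation condition extended to finitely supported input sequences. -/
theorem hasSum_inner_indicator
    (hint : ∀ (u : U) (x : X), HasSum (fun j => inner (𝕜 := ℂ) (E ((T ^ j) x)) (Sc j u))
      (inner (𝕜 := ℂ) (N x) u)) (h : ℕ → U) (s : Finset ℕ) (x : X) :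
    HasSum (fun l => inner (𝕜 := ℂ) (E ((T ^ l) x))
        (∑ j ∈ Finset.range (l + 1), Sc j ((s : Set ℕ).indicator h (l - j))))
      (∑ k ∈ s, inner (𝕜 := ℂ) (N ((T ^ k) x)) (h k)) := by
  simp_rw [sum_range_apply_indicator, inner_sum]
  refine hasSum_sum fun k _ => ?_
  refine ((add_left_injective k).hasSum_iff fun l hl => ?_).1 ?_
  · have : ¬ k ≤ l := fun hkl => hl ⟨l - k, Nat.sub_add_cancel hkl⟩
    simp [this]
  · convert hint (h k) ((T ^ k) x) using 2 with j
    simp [Function.iterate_add_apply]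

/-- Pairing the output of a contractive multiplier with an observability sequence. -/
theorem summable_inner_and_norm_tsum_sq_le_of_multiplier {β : ℕ → ℝ} (hβ : ∀ j, 0 < β j) {C : ℝ}
    {x : X} (hsum : Summable fun j => (β j)⁻¹ * ‖E ((T ^ j) x)‖ ^ 2)
    (hle : ∑' j, (β j)⁻¹ * ‖E ((T ^ j) x)‖ ^ 2 ≤ C * ‖x‖ ^ 2)
    (hmult : IsContractiveMultiplier β Sc) {h : ℕ → U} (hh : Summable fun k => ‖h k‖ ^ 2) :
    Summable (fun l => inner (𝕜 := ℂ) (E ((T ^ l) x))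
        (∑ j ∈ Finset.range (l + 1), Sc j (h (l - j)))) ∧
      ‖∑' l, inner (𝕜 := ℂ) (E ((T ^ l) x))
        (∑ j ∈ Finset.range (l + 1), Sc j (h (l - j)))‖ ^ 2 ≤
        C * ‖x‖ ^ 2 * ∑' k, ‖h k‖ ^ 2 := by
  obtain ⟨h1, h2⟩ := hmult h hh
  obtain ⟨h3, h4⟩ := summable_inner_and_norm_tsum_sq_le hβ hsum h1
  refine ⟨h3, h4.trans (mul_le_mul hle h2 (tsum_nonneg fun l => ?_) (le_trans ?_ hle))⟩
  · have := hβ l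
    positivity
  · exact tsum_nonneg fun l => by have := hβ l; positivity

theorem sum_norm_sq_le_of_multiplier {β : ℕ → ℝ} (hβ : ∀ j, 0 < β j) {C : ℝ}
    {x : X} (hsum : Summable fun j => (β j)⁻¹ * ‖E ((T ^ j) x)‖ ^ 2)
    (hle : ∑' j, (β j)⁻¹ * ‖E ((T ^ j) x)‖ ^ 2 ≤ C * ‖x‖ ^ 2)
    (hmult : IsContractiveMultiplier β Sc)
    (hint : ∀ (u : U) (x : X), HasSum (fun j => inner (𝕜 := ℂ) (E ((T ^ j) x)) (Sc j u))
      (inner (𝕜 := ℂ) (N x) u)) (s : Finset ℕ) :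
    ∑ k ∈ s, ‖N ((T ^ k) x)‖ ^ 2 ≤ C * ‖x‖ ^ 2 := by
  set h : ℕ → U := fun k => N ((T ^ k) x)
  have hind := hasSum_norm_sq_indicator h s
  have hbound := (summable_inner_and_norm_tsum_sq_le_of_multiplier hβ hsum hle hmult
    hind.summable).2
  have hinner : ∑ k ∈ s, inner (𝕜 := ℂ) (h k) (h k) = ((∑ k ∈ s, ‖h k‖ ^ 2 : ℝ) : ℂ) := by
    push_cast
    exact Finset.sum_congr rfl fun k _ => inner_self_eq_norm_sq_to_K _
  rw [(hasSum_inner_indicator hint h s x).tsum_eq, hind.tsum_eq, hinner, Complex.norm_real,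
    Real.norm_eq_abs, sq_abs] at hbound
  rcases (Finset.sum_nonneg fun k _ => sq_nonneg ‖h k‖ : 0 ≤ ∑ k ∈ s, ‖h k‖ ^ 2).eq_or_lt with
    h0 | hpos
  · rw [← h0]
    exact le_trans (tsum_nonneg fun l => by have := hβ l; positivity) hle
  · exact le_of_mul_le_mul_right (by rwa [sq] at hbound) hpos

theorem hasSum_inner_of_multiplier {β : ℕ → ℝ} (hβ : ∀ j, 0 < β j) {C : ℝ}
    {x : X} (hsum : Summable fun j => (β j)⁻¹ * ‖E ((T ^ j) x)‖ ^ 2)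
    (hle : ∑' j, (β j)⁻¹ * ‖E ((T ^ j) x)‖ ^ 2 ≤ C * ‖x‖ ^ 2)
    (hmult : IsContractiveMultiplier β Sc)
    (hint : ∀ (u : U) (x : X), HasSum (fun j => inner (𝕜 := ℂ) (E ((T ^ j) x)) (Sc j u))
      (inner (𝕜 := ℂ) (N x) u)) {h : ℕ → U} (hh : Summable fun k => ‖h k‖ ^ 2) :
    HasSum (fun k => inner (𝕜 := ℂ) (N ((T ^ k) x)) (h k))
      (∑' l, inner (𝕜 := ℂ) (E ((T ^ l) x))
        (∑ j ∈ Finset.range (l + 1), Sc j (h (l - j)))) := by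
  have hfull := (summable_inner_and_norm_tsum_sq_le_of_multiplier hβ hsum hle hmult hh).1.hasSum
  set L := ∑' l, inner (𝕜 := ℂ) (E ((T ^ l) x)) (∑ j ∈ Finset.range (l + 1), Sc j (h (l - j)))
  obtain ⟨A, hA⟩ := hh
  have hbound : ∀ s : Finset ℕ, ‖L - ∑ k ∈ s, inner (𝕜 := ℂ) (N ((T ^ k) x)) (h k)‖ ^ 2 ≤
      C * ‖x‖ ^ 2 * (A - ∑ k ∈ s, ‖h k‖ ^ 2) := fun s => by
    have htail : HasSum (fun k => ‖h k - (s : Set ℕ).indicator h k‖ ^ 2)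
        (A - ∑ k ∈ s, ‖h k‖ ^ 2) := by
      have hpt : ∀ k, ‖h k - (s : Set ℕ).indicator h k‖ ^ 2 =
          ‖h k‖ ^ 2 - ‖(s : Set ℕ).indicator h k‖ ^ 2 := fun k => by
        by_cases hk : k ∈ s <;> simp [hk]
      simpa only [hpt] using hA.sub (hasSum_norm_sq_indicator h s)
    have hdiff := hfull.sub (hasSum_inner_indicator hint h s x)
    have := (summable_inner_and_norm_tsum_sq_le_of_multiplier hβ hsum hle hmult
      htail.summable).2
    simp_rw [← inner_sub_right, ← Finset.sum_sub_distrib, ← map_sub] at hdiff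
    rwa [htail.tsum_eq, hdiff.tsum_eq] at this
  have hzero : Tendsto (fun s : Finset ℕ => C * ‖x‖ ^ 2 *
      (A - ∑ k ∈ s, ‖h k‖ ^ 2)) atTop (nhds 0) := by
    have hT : Tendsto (fun s : Finset ℕ => ∑ k ∈ s, ‖h k‖ ^ 2) atTop (nhds A) := hA
    simpa only [sub_self, mul_zero] using (hT.const_sub A).const_mul (C * ‖x‖ ^ 2)
  have hsq := (squeeze_zero (fun _ => sq_nonneg _) hbound hzero).sqrt
  simp only [Real.sqrt_sq (norm_nonneg _), Real.sqrt_zero] at hsq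
  exact tendsto_iff_norm_sub_tendsto_zero.2 (hsq.congr fun _ => norm_sub_rev _ _)

end Interpolation

theorem stmt3 {X U Y : Type*}
    [NormedAddCommGroup X] [InnerProductSpace ℂ X] [CompleteSpace X]
    [NormedAddCommGroup U] [InnerProductSpace ℂ U] [CompleteSpace U]
    [NormedAddCommGroup Y] [InnerProductSpace ℂ Y] [CompleteSpace Y]
    (β : ℕ → ℝ) (hβ : IsWeightSeq β)
    (T : X →L[ℂ] X) (E : X →L[ℂ] Y) (N : X →L[ℂ] U)
    (hET : OutputStable β E T)
    (S : ℂ → (U →L[ℂ] Y)) (Sc : ℕ → (U →L[ℂ] Y))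
    (hTaylor : ∀ z ∈ ball (0 : ℂ) 1, HasSum (fun j => z ^ j • Sc j) (S z))
    (hmult : IsContractiveMultiplier β Sc)
    -- the interpolation condition `(E*S)^{∧L}(T*) = N*`:
    -- `Σ_j ⟨Sc j u, E T^j x⟩_Y` converges to `⟨u, N x⟩_U`
    (hint : ∀ (u : U) (x : X),
      HasSum (fun j => inner (𝕜 := ℂ) (E ((T ^ j) x)) (Sc j u))
        (inner (𝕜 := ℂ) (N x) u)) :
    -- (a) `(N,T)` is 1-output stable
    OutputStable (fun _ => 1) N T ∧
    -- (b) the two series agree for every ℓ²-input `h` and every `x`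
    (∀ h : ℕ → U, Summable (fun k => ‖h k‖ ^ 2) → ∀ x : X, ∃ s : ℂ,
      HasSum (fun ℓ => inner (𝕜 := ℂ) (E ((T ^ ℓ) x))
        (∑ j ∈ Finset.range (ℓ + 1), Sc j (h (ℓ - j)))) s ∧
      HasSum (fun k => inner (𝕜 := ℂ) (N ((T ^ k) x)) (h k)) s) ∧
    -- (c) the Stein identity in quadratic form
    (∀ x : X, (∑' j, ‖N ((T ^ j) x)‖ ^ 2) - (∑' j, ‖N ((T ^ (j + 1)) x)‖ ^ 2)
      = ‖N x‖ ^ 2) := by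
  obtain ⟨hpos, -, -⟩ := hβ
  obtain ⟨C, hC, hstab⟩ := hET
  have hpartial : ∀ (x : X) (s : Finset ℕ), ∑ k ∈ s, ‖N ((T ^ k) x)‖ ^ 2 ≤ C * ‖x‖ ^ 2 :=
    fun x => sum_norm_sq_le_of_multiplier hpos (hstab x).1 (hstab x).2 hmult hint
  have hsummable : ∀ x : X, Summable fun k => ‖N ((T ^ k) x)‖ ^ 2 := fun x =>
    summable_of_sum_le (fun _ => sq_nonneg _) (hpartial x)
  refine ⟨⟨C, hC, fun x => ?_⟩, fun h hh x => ?_, fun x => ?_⟩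
  · simp only [inv_one, one_mul]
    exact ⟨hsummable x, (hsummable x).tsum_le_of_sum_le (hpartial x)⟩
  · exact ⟨_, (summable_inner_and_norm_tsum_sq_le_of_multiplier hpos (hstab x).1 (hstab x).2
      hmult hh).1.hasSum, hasSum_inner_of_multiplier hpos (hstab x).1 (hstab x).2 hmult hint hh⟩
  · rw [(hsummable x).tsum_eq_zero_add]
    simp
end
end

section
/- Let β be a non-increasing weight sequence, X, Y complex Hilbert spaces, T ∈ L(X), E ∈ L(X,Y), with the pair (E,T) β-output stable. Then for every x ∈ X the series Σ_{j≥0} c_j ‖E T^j x‖² converges and Σ_{j≥0} c_j ‖E T^j x‖² = Σ_{j≥0} β_j^{-1} ‖E T^j x‖² − Σ_{j≥0} β_j^{-1} ‖E T^{j+1} x‖². In particular, the map x ↦ (√(c_j) E T^j x)_{j≥0} defines a bounded linear operator from X into ℓ²(Y). -/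
open Metric Filter

noncomputable section

/-- A sequence of operators whose squared norms are summable at each point, with sums controlled by
`C * ‖x‖ ^ 2`, assembles into a bounded operator into `ℓ²`. -/
theorem exists_clm_lp_two_of_tsum_sq_le {𝕜 X Y : Type*} [NontriviallyNormedField 𝕜]
    [SeminormedAddCommGroup X] [NormedSpace 𝕜 X] [NormedAddCommGroup Y] [NormedSpace 𝕜 Y]
    (A : ℕ → X →L[𝕜] Y) {C : ℝ} (hC : 0 ≤ C) (hs : ∀ x, Summable fun j => ‖A j x‖ ^ 2)
    (hle : ∀ x, ∑' j, ‖A j x‖ ^ 2 ≤ C * ‖x‖ ^ 2) :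
    ∃ O : X →L[𝕜] lp (fun _ : ℕ => Y) 2, ∀ x j, O x j = A j x := by
  have hmem (x : X) : Memℓp (fun j => A j x) 2 := memℓp_gen (by simpa using hs x)
  let L : X →ₗ[𝕜] lp (fun _ : ℕ => Y) 2 :=
    { toFun := fun x => ⟨fun j => A j x, hmem x⟩
      map_add' := fun x y => by ext j; exact (A j).map_add x y
      map_smul' := fun a x => by ext j; exact (A j).map_smul a x }
  refine ⟨L.mkContinuous √C fun x => ?_, fun x j => rfl⟩
  refine lp.norm_le_of_tsum_le (by norm_num) (by positivity) ?_
  have h : (√C * ‖x‖) ^ 2 = C * ‖x‖ ^ 2 := by rw [mul_pow, Real.sq_sqrt hC]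
  simpa [L, h] using hle x

/-- Summation by parts for the series with the differences of `b` as coefficients. -/
theorem hasSum_diff_mul {a b c : ℕ → ℝ} (hc0 : c 0 = b 0) (hcs : ∀ j, c (j + 1) = b (j + 1) - b j)
    (h : Summable fun j => b j * a j) (h' : Summable fun j => b j * a (j + 1)) :
    HasSum (fun j => c j * a j) (∑' j, b j * a j - ∑' j, b j * a (j + 1)) := by
  have hsucc : HasSum (fun j => c (j + 1) * a (j + 1))
      (∑' j, b (j + 1) * a (j + 1) - ∑' j, b j * a (j + 1)) := by
    simpa only [hcs, sub_mul] using ((summable_nat_add_iff 1).2 h).hasSum.sub h'.hasSum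
  have hsum := HasSum.zero_add (f := fun j => c j * a j) hsucc
  rwa [hc0, ← add_sub_assoc, ← h.tsum_eq_zero_add] at hsum

theorem stmt4 {X Y : Type*}
    [NormedAddCommGroup X] [InnerProductSpace ℂ X] [CompleteSpace X]
    [NormedAddCommGroup Y] [InnerProductSpace ℂ Y] [CompleteSpace Y]
    (β : ℕ → ℝ) (hβ : IsWeightSeq β) (hmono : ∀ j, β (j + 1) ≤ β j)
    (c : ℕ → ℝ) (hc0 : c 0 = 1) (hcs : ∀ j, c (j + 1) = (β (j + 1))⁻¹ - (β j)⁻¹)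
    (T : X →L[ℂ] X) (E : X →L[ℂ] Y) (hET : OutputStable β E T) :
    (∀ x : X,
      Summable (fun j => c j * ‖E ((T ^ j) x)‖ ^ 2) ∧
      ∑' j, c j * ‖E ((T ^ j) x)‖ ^ 2
        = (∑' j, (β j)⁻¹ * ‖E ((T ^ j) x)‖ ^ 2)
            - ∑' j, (β j)⁻¹ * ‖E ((T ^ (j + 1)) x)‖ ^ 2) ∧
    -- `x ↦ (√(c_j) E T^j x)_{j≥0}` defines a bounded linear operator `X → ℓ²(Y)`
    (∃ O : X →L[ℂ] lp (fun _ : ℕ => Y) 2,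
      ∀ (x : X) (j : ℕ), (O x) j = (Real.sqrt (c j) : ℂ) • E ((T ^ j) x)) := by
  obtain ⟨hpos, hβ0, -⟩ := hβ
  obtain ⟨C, hC, hstable⟩ := hET
  have hc (j : ℕ) : 0 ≤ c j := by
    cases j with
    | zero => simp [hc0]
    | succ j => rw [hcs, sub_nonneg]; exact inv_anti₀ (hpos _) (hmono j)
  have hsum (x : X) : HasSum (fun j => c j * ‖E ((T ^ j) x)‖ ^ 2)
      ((∑' j, (β j)⁻¹ * ‖E ((T ^ j) x)‖ ^ 2)
        - ∑' j, (β j)⁻¹ * ‖E ((T ^ (j + 1)) x)‖ ^ 2) :=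
    hasSum_diff_mul (a := fun j => ‖E ((T ^ j) x)‖ ^ 2) (b := fun j => (β j)⁻¹)
      (by simp [hc0, hβ0]) hcs (hstable x).1 (by simpa [pow_succ] using (hstable (T x)).1)
  refine ⟨fun x => ⟨(hsum x).summable, (hsum x).tsum_eq⟩, ?_⟩
  have hsq (x : X) (j : ℕ) : ‖((Real.sqrt (c j) : ℂ) • E.comp (T ^ j)) x‖ ^ 2
      = c j * ‖E ((T ^ j) x)‖ ^ 2 := by
    simp [norm_smul, mul_pow, abs_of_nonneg (Real.sqrt_nonneg _), Real.sq_sqrt (hc j)]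
  refine exists_clm_lp_two_of_tsum_sq_le
    (fun j => (Real.sqrt (c j) : ℂ) • E.comp (T ^ j)) hC (fun x => ?_) fun x => ?_
  · simpa only [hsq] using (hsum x).summable
  · simp only [hsq]
    rw [(hsum x).tsum_eq]
    refine (sub_le_self _ (tsum_nonneg fun j => ?_)).trans (hstable x).2
    have := hpos j
    positivity
end
end

section
/- Let β be a non-increasing weight sequence, X, Y complex Hilbert spaces, T ∈ L(X), E ∈ L(X,Y), with the pair (E,T) β-output stable. Then for every x ∈ X the iterated series Σ_{j≥0} ( Σ_{k≥0} c_k ‖E T^{j+k} x‖² ) converges and equals Σ_{j≥0} β_j^{-1} ‖E T^j x‖². In particular, the pair (Õ_{β,E,T}, T), where Õ_{β,E,T} : X → ℓ²(Y) is the bounded operator x ↦ (√(c_j) E T^j x)_{j≥0}, is 1-output stable. -/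
open Metric Filter

noncomputable section

/-- Tonelli's theorem along antidiagonals: summing `c k * b (j + k)` first over `k` and then
over `j` gives the sum of the partial sums of `c` against `b`. -/
theorem tsum_tsum_mul_add_eq {b c S : ℕ → ℝ} (hb : ∀ n, 0 ≤ b n) (hc : ∀ n, 0 ≤ c n)
    (hS : ∀ n, ∑ k ∈ Finset.range (n + 1), c k = S n) (h : Summable fun n => S n * b n) :
    (∀ j, Summable fun k => c k * b (j + k)) ∧
      (Summable fun j => ∑' k, c k * b (j + k)) ∧
      ∑' j, ∑' k, c k * b (j + k) = ∑' n, S n * b n := by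
  set f : ℕ × ℕ → ℝ := fun p => c p.2 * b (p.1 + p.2) with hf
  have hf0 : ∀ p, 0 ≤ f p := fun p => mul_nonneg (hc _) (hb _)
  have hfib : ∀ n, ∑ p ∈ Finset.HasAntidiagonal.antidiagonal n, f p = S n * b n := by
    intro n
    rw [← hS n, Finset.sum_mul, ← Finset.sum_range_reflect,
      Finset.Nat.sum_antidiagonal_eq_sum_range_succ_mk]
    refine Finset.sum_congr rfl fun k hk => ?_
    have hk' : k ≤ n := Nat.lt_succ_iff.mp (Finset.mem_range.mp hk)
    simp only [hf, Nat.add_sub_cancel, Nat.add_sub_cancel' hk']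
  have hfib' : ∀ n, ∑' p : Finset.HasAntidiagonal.antidiagonal n, f p = S n * b n := fun n => by
    rw [Finset.tsum_subtype, hfib]
  have hsum : Summable (f ∘ Finset.HasAntidiagonal.sigmaAntidiagonalEquivProd) := by
    refine (summable_sigma_of_nonneg fun p => hf0 _).2 ⟨fun n => Summable.of_finite, ?_⟩
    exact h.congr fun n => (hfib' n).symm
  have hfs : Summable f := (Equiv.summable_iff _).1 hsum
  refine ⟨fun j => hfs.prod_factor j, hfs.prod, ?_⟩
  rw [← hfs.tsum_prod, ← Finset.HasAntidiagonal.sigmaAntidiagonalEquivProd.tsum_eq f]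
  exact hsum.tsum_sigma.trans (tsum_congr hfib')

theorem stmt5 {X Y : Type*}
    [NormedAddCommGroup X] [InnerProductSpace ℂ X] [CompleteSpace X]
    [NormedAddCommGroup Y] [InnerProductSpace ℂ Y] [CompleteSpace Y]
    (β : ℕ → ℝ) (hβ : IsWeightSeq β) (hmono : ∀ j, β (j + 1) ≤ β j)
    (c : ℕ → ℝ) (hc0 : c 0 = 1) (hcs : ∀ j, c (j + 1) = (β (j + 1))⁻¹ - (β j)⁻¹)
    (T : X →L[ℂ] X) (E : X →L[ℂ] Y) (hET : OutputStable β E T) :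
    -- the iterated series converges and equals `Σ_j β_j⁻¹ ‖E T^j x‖²`
    (∀ x : X,
      (∀ j, Summable (fun k => c k * ‖E ((T ^ (j + k)) x)‖ ^ 2)) ∧
      Summable (fun j => ∑' k, c k * ‖E ((T ^ (j + k)) x)‖ ^ 2) ∧
      ∑' j, (∑' k, c k * ‖E ((T ^ (j + k)) x)‖ ^ 2)
        = ∑' j, (β j)⁻¹ * ‖E ((T ^ j) x)‖ ^ 2) ∧
    -- in particular, `(Õ_{β,E,T}, T)` is 1-output stable
    (∀ O : X →L[ℂ] lp (fun _ : ℕ => Y) 2,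
      (∀ (x : X) (j : ℕ), (O x) j = (Real.sqrt (c j) : ℂ) • E ((T ^ j) x)) →
      OutputStable (fun _ => 1) O T) := by
  obtain ⟨hpos, hβ0, -⟩ := hβ
  obtain ⟨C, hC, hstab⟩ := hET
  have hc : ∀ n, 0 ≤ c n := by
    rintro (_ | n)
    · simp [hc0]
    · rw [hcs, sub_nonneg]
      exact inv_anti₀ (hpos _) (hmono n)
  have hS : ∀ n, ∑ k ∈ Finset.range (n + 1), c k = (β n)⁻¹ := by
    intro n
    induction n with
    | zero => simp [hc0, hβ0]
    | succ n ih => rw [Finset.sum_range_succ, ih, hcs]; ring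
  have key := fun x : X =>
    tsum_tsum_mul_add_eq (b := fun n => ‖E ((T ^ n) x)‖ ^ 2) (fun n => sq_nonneg _) hc hS
      (hstab x).1
  refine ⟨key, fun O hO => ⟨C, hC, fun x => ?_⟩⟩
  have hnorm : ∀ j, ‖O ((T ^ j) x)‖ ^ 2 = ∑' k, c k * ‖E ((T ^ (j + k)) x)‖ ^ 2 := by
    intro j
    have h2 := lp.norm_rpow_eq_tsum (p := 2) (by norm_num) (O ((T ^ j) x))
    simp only [ENNReal.toReal_ofNat, Real.rpow_ofNat] at h2
    rw [h2]
    refine tsum_congr fun k => ?_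
    rw [hO, norm_smul, Complex.norm_real, mul_pow, Real.norm_of_nonneg (Real.sqrt_nonneg _),
      Real.sq_sqrt (hc k), add_comm j k, pow_add, mul_apply_eq_comp]
  obtain ⟨-, h1, h2⟩ := key x
  simp only [inv_one, one_mul, hnorm]
  exact ⟨h1, h2.trans_le (hstab x).2⟩
end
end

section
/- Let β be a non-increasing weight sequence, X, U, Y complex Hilbert spaces, T ∈ L(X), E ∈ L(X,Y), with (E,T) β-output stable. Let 𝐒 be in the Schur class S(U, ℓ²(Y)), with component functions 𝐒_j : 𝔻 → L(U,Y) (the j-th entry of 𝐒(z)u being 𝐒_j(z)u) having Taylor expansions 𝐒_j(z) = Σ_{k≥0} 𝐒_{j,k} z^k, and let S = Ψ_β 𝐒, so that S is analytic on 𝔻 with Taylor coefficients S_ℓ = Σ_{k=0}^{ℓ} √(c_k) 𝐒_{k,ℓ−k}. Then for every u ∈ U and x ∈ X, the series Σ_{ℓ≥0} ⟨S_ℓ u, E T^ℓ x⟩_Y and the iterated series Σ_{k≥0} ( Σ_{j≥0} √(c_j) ⟨𝐒_{j,k} u, E T^{j+k} x⟩_Y ) both converge and are equal. -/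
open Metric Filter

noncomputable section

theorem summable_norm_pow_smul_of_hasSum {Y : Type*} [NormedAddCommGroup Y] [NormedSpace ℂ Y]
    {a : ℕ → Y} {g : ℂ → Y}
    (h : ∀ z ∈ ball (0 : ℂ) 1, HasSum (fun k => z ^ k • a k) (g z))
    {r : ℝ} (hr0 : 0 ≤ r) (hr1 : r < 1) : Summable fun k => r ^ k * ‖a k‖ := by
  obtain ⟨q, hrq, hq1⟩ := exists_between hr1
  have hq0 : 0 < q := hr0.trans_lt hrq
  have hq : (q : ℂ) ∈ ball (0 : ℂ) 1 := by
    simpa [abs_of_pos hq0] using hq1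
  have hlim := (h q hq).summable.tendsto_atTop_zero.norm
  obtain ⟨C, hC⟩ := hlim.bddAbove_range
  have hC' : ∀ k, q ^ k * ‖a k‖ ≤ C := fun k => by
    have := hC (Set.mem_range_self k)
    simpa [norm_smul, abs_of_pos hq0] using this
  have hgeo : Summable fun k : ℕ => C * (r / q) ^ k :=
    (summable_geometric_of_lt_one (by positivity) ((div_lt_one hq0).2 hrq)).mul_left C
  refine hgeo.of_nonneg_of_le (fun k => by positivity) fun k => ?_
  calc r ^ k * ‖a k‖ = (q ^ k * ‖a k‖) * (r / q) ^ k := by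
        rw [div_pow]; field_simp
    _ ≤ C * (r / q) ^ k := by gcongr; exact hC' k

theorem hasSum_inner_prod {ι Y : Type*} [NormedAddCommGroup Y] [InnerProductSpace ℂ Y]
    [CompleteSpace Y] {b : ι → Y} {y : Y} (hb : Summable fun k => ‖b k‖) (hy : HasSum b y) :
    HasSum (fun p : ι × ι => inner (𝕜 := ℂ) (b p.1) (b p.2)) (inner (𝕜 := ℂ) y y) := by
  have hs : Summable (fun p : ι × ι => inner (𝕜 := ℂ) (b p.1) (b p.2)) :=
    (hb.mul_of_nonneg hb (fun _ => norm_nonneg _) (fun _ => norm_nonneg _)).of_norm_bounded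
      fun p => norm_inner_le_norm _ _
  have h1 : ∀ k, HasSum (fun l => inner (𝕜 := ℂ) (b k) (b l)) (inner (𝕜 := ℂ) (b k) y) :=
    fun k => hy.mapL (innerSL ℂ (b k))
  have h2 : HasSum (fun k => inner (𝕜 := ℂ) (b k) y) (inner (𝕜 := ℂ) y y) := by
    have := (hy.mapL (innerSL ℂ y)).star
    simpa using this
  have := hs.hasSum.prod_fiberwise h1
  rw [h2.unique this]
  exact hs.hasSum

theorem integral_exp_int_mul (n : ℤ) :
    ∫ θ in (0 : ℝ)..2 * Real.pi, Complex.exp (n * θ * Complex.I) =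
      if n = 0 then (2 * Real.pi : ℂ) else 0 := by
  split_ifs with hn
  · simp [hn]
  · have hc : (n * Complex.I : ℂ) ≠ 0 := by simp [hn]
    have := integral_exp_mul_complex (a := 0) (b := 2 * Real.pi) hc
    have h2 : (n * Complex.I : ℂ) * ((2 * Real.pi : ℝ) : ℂ) = n * (2 * Real.pi * Complex.I) := by
      push_cast; ring
    rw [h2, Complex.exp_int_mul_two_pi_mul_I] at this
    simp only [Complex.ofReal_zero, mul_zero, Complex.exp_zero, sub_self, zero_div] at this
    rw [← this]
    congr 1; ext θ; ring_nf

theorem integral_inner_exp_smul {Y : Type*} [NormedAddCommGroup Y] [InnerProductSpace ℂ Y]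
    (b : ℕ → Y) (k l : ℕ) :
    ∫ θ in (0 : ℝ)..2 * Real.pi, inner (𝕜 := ℂ) (Complex.exp (θ * Complex.I) ^ k • b k)
      (Complex.exp (θ * Complex.I) ^ l • b l) =
      if k = l then ((2 * Real.pi * ‖b k‖ ^ 2 : ℝ) : ℂ) else 0 := by
  have hf : ∀ θ : ℝ, inner (𝕜 := ℂ) (Complex.exp (θ * Complex.I) ^ k • b k)
      (Complex.exp (θ * Complex.I) ^ l • b l) =
      Complex.exp ((((l : ℤ) - k : ℤ) : ℂ) * θ * Complex.I) * inner (𝕜 := ℂ) (b k) (b l) := by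
    intro θ
    rw [inner_smul_left, inner_smul_right, ← mul_assoc]
    congr 1
    rw [map_pow, ← Complex.exp_conj, ← Complex.exp_nat_mul, ← Complex.exp_nat_mul,
      ← Complex.exp_add]
    congr 1
    simp
    ring
  simp_rw [hf]
  rw [intervalIntegral.integral_mul_const, integral_exp_int_mul]
  by_cases h : k = l
  · simp [h, inner_self_eq_norm_sq_to_K]
  · have : ¬ ((l : ℤ) - k = 0) := by omega
    simp [h, this]

/-- Parseval's identity for absolutely convergent one-sided Fourier series with values in a
Hilbert space. -/
theorem hasSum_norm_sq_integral {Y : Type*} [NormedAddCommGroup Y] [InnerProductSpace ℂ Y]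
    [CompleteSpace Y] {b : ℕ → Y} (hb : Summable fun k => ‖b k‖) {g : ℝ → Y}
    (hg : ∀ θ : ℝ, HasSum (fun k : ℕ => Complex.exp (θ * Complex.I) ^ k • b k) (g θ)) :
    Continuous g ∧ HasSum (fun k => 2 * Real.pi * ‖b k‖ ^ 2)
      (∫ θ in (0 : ℝ)..2 * Real.pi, ‖g θ‖ ^ 2) := by
  have hnorm : ∀ (θ : ℝ) k, ‖Complex.exp (θ * Complex.I) ^ k • b k‖ = ‖b k‖ := fun θ k => by
    rw [norm_smul, norm_pow, Complex.norm_exp_ofReal_mul_I, one_pow, one_mul]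
  have hgc : Continuous g := by
    have : g = fun θ : ℝ => ∑' k : ℕ, Complex.exp (θ * Complex.I) ^ k • b k :=
      funext fun θ => (hg θ).tsum_eq.symm
    rw [this]
    exact continuous_tsum (fun k => by fun_prop) hb fun k θ => (hnorm θ k).le
  refine ⟨hgc, ?_⟩
  have hbb : Summable fun p : ℕ × ℕ => ‖b p.1‖ * ‖b p.2‖ :=
    hb.mul_of_nonneg hb (fun _ => norm_nonneg _) (fun _ => norm_nonneg _)
  have hsum : HasSum (fun p : ℕ × ℕ => ∫ θ in (0 : ℝ)..2 * Real.pi,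
      inner (𝕜 := ℂ) (Complex.exp (θ * Complex.I) ^ p.1 • b p.1)
        (Complex.exp (θ * Complex.I) ^ p.2 • b p.2))
      (∫ θ in (0 : ℝ)..2 * Real.pi, inner (𝕜 := ℂ) (g θ) (g θ)) := by
    refine intervalIntegral.hasSum_integral_of_dominated_convergence
      (fun p _ => ‖b p.1‖ * ‖b p.2‖) (fun p => ?_) (fun p => ?_)
      (Filter.Eventually.of_forall fun θ _ => hbb) intervalIntegrable_const
      (Filter.Eventually.of_forall fun θ _ => ?_)
    · exact Continuous.aestronglyMeasurable (by fun_prop)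
    · refine Filter.Eventually.of_forall fun θ _ => (norm_inner_le_norm _ _).trans_eq ?_
      rw [hnorm, hnorm]
    · exact hasSum_inner_prod (b := fun k : ℕ => Complex.exp (θ * Complex.I) ^ k • b k)
        (by simpa only [hnorm] using hb) (hg θ)
  simp_rw [integral_inner_exp_smul, inner_self_eq_norm_sq_to_K] at hsum
  have hinj : Function.Injective fun k : ℕ => (k, k) := fun k l h => (Prod.ext_iff.1 h).1
  rw [← hinj.hasSum_iff (by
    rintro ⟨k, l⟩ hkl
    refine if_neg fun h => hkl ⟨k, ?_⟩
    exact Prod.ext rfl h)] at hsum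
  have hre := Complex.hasSum_re hsum
  have hval : ∫ θ in (0 : ℝ)..2 * Real.pi, ((‖g θ‖ : ℂ)) ^ 2 =
      ((∫ θ in (0 : ℝ)..2 * Real.pi, ‖g θ‖ ^ 2 : ℝ) : ℂ) := by
    rw [← intervalIntegral.integral_ofReal]
    simp
  simp only [Complex.coe_algebraMap, hval, Complex.ofReal_re] at hre
  simpa [Function.comp_def, ← Complex.ofReal_pow] using hre

/-- The Taylor coefficients of an `ℓ²`-valued function bounded by `M` on the disk are
square summable. -/
theorem summable_norm_sq_coeff {Y : Type*} [NormedAddCommGroup Y] [InnerProductSpace ℂ Y]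
    [CompleteSpace Y] {G : ℂ → lp (fun _ : ℕ => Y) 2} {a : ℕ → ℕ → Y} {M : ℝ}
    (hG : ∀ z ∈ ball (0 : ℂ) 1, ‖G z‖ ≤ M)
    (ha : ∀ j, ∀ z ∈ ball (0 : ℂ) 1, HasSum (fun k => z ^ k • a j k) (G z j)) :
    Summable fun p : ℕ × ℕ => ‖a p.1 p.2‖ ^ 2 := by
  have hr : ∀ r : ℝ, 0 ≤ r → r < 1 → ∀ s t : Finset ℕ,
      ∑ j ∈ s, ∑ k ∈ t, (r ^ k * ‖a j k‖) ^ 2 ≤ M ^ 2 := by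
    intro r hr0 hr1 s t
    have hz : ∀ θ : ℝ, (r : ℂ) * Complex.exp (θ * Complex.I) ∈ ball (0 : ℂ) 1 := fun θ => by
      rw [mem_ball_zero_iff, norm_mul, Complex.norm_exp_ofReal_mul_I, mul_one,
        Complex.norm_real, Real.norm_of_nonneg hr0]
      exact hr1
    have hn : ∀ j k, ‖(r : ℂ) ^ k • a j k‖ = r ^ k * ‖a j k‖ := fun j k => by
      rw [norm_smul, norm_pow, Complex.norm_real, Real.norm_of_nonneg hr0]
    have hp := fun j => hasSum_norm_sq_integral (b := fun k => (r : ℂ) ^ k • a j k)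
      (g := fun θ => G (r * Complex.exp (θ * Complex.I)) j)
      (by simpa only [hn] using summable_norm_pow_smul_of_hasSum (ha j) hr0 hr1)
      (fun θ => by
        convert ha j _ (hz θ) using 2 with k
        rw [smul_smul, mul_pow, mul_comm])
    have hpt : ∀ θ : ℝ, ∑ j ∈ s, ‖G (r * Complex.exp (θ * Complex.I)) j‖ ^ 2 ≤ M ^ 2 := by
      intro θ
      have h1 := lp.sum_rpow_le_norm_rpow (p := 2) (by norm_num)
        (G (r * Complex.exp (θ * Complex.I))) s
      norm_num at h1
      exact h1.trans (pow_le_pow_left₀ (norm_nonneg _) (hG _ (hz θ)) 2)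
    have hpi : (0 : ℝ) < 2 * Real.pi := by positivity
    refine le_of_mul_le_mul_left ?_ hpi
    calc 2 * Real.pi * ∑ j ∈ s, ∑ k ∈ t, (r ^ k * ‖a j k‖) ^ 2
        = ∑ j ∈ s, ∑ k ∈ t, 2 * Real.pi * ‖(r : ℂ) ^ k • a j k‖ ^ 2 := by
          simp_rw [hn, Finset.mul_sum]
      _ ≤ ∑ j ∈ s, ∫ θ in (0 : ℝ)..2 * Real.pi,
            ‖G (r * Complex.exp (θ * Complex.I)) j‖ ^ 2 :=
          Finset.sum_le_sum fun j _ => sum_le_hasSum t (fun _ _ => by positivity) (hp j).2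
      _ = ∫ θ in (0 : ℝ)..2 * Real.pi,
            ∑ j ∈ s, ‖G (r * Complex.exp (θ * Complex.I)) j‖ ^ 2 :=
          (intervalIntegral.integral_finsetSum fun j _ =>
            ((hp j).1.norm.pow 2).intervalIntegrable _ _).symm
      _ ≤ ∫ θ in (0 : ℝ)..2 * Real.pi, M ^ 2 :=
          intervalIntegral.integral_mono_on hpi.le
            ((continuous_finsetSum s fun j _ => (hp j).1.norm.pow 2).intervalIntegrable _ _)
            intervalIntegrable_const fun θ _ => hpt θ
      _ = 2 * Real.pi * M ^ 2 := by simp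
  have h1 : ∀ s t : Finset ℕ, ∑ j ∈ s, ∑ k ∈ t, ‖a j k‖ ^ 2 ≤ M ^ 2 := by
    intro s t
    have hc : Continuous fun r : ℝ => ∑ j ∈ s, ∑ k ∈ t, (r ^ k * ‖a j k‖) ^ 2 := by fun_prop
    have hlim := (hc.tendsto 1).mono_left (nhdsWithin_le_nhds (s := Set.Iio 1))
    simp only [one_pow, one_mul] at hlim
    refine le_of_tendsto hlim ?_
    filter_upwards [Ioo_mem_nhdsLT (zero_lt_one (α := ℝ))] with r h
    exact hr r h.1.le h.2 s t
  refine summable_of_sum_le (c := M ^ 2) (fun p => by positivity) fun u => ?_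
  refine le_trans ?_ (h1 (u.image Prod.fst) (u.image Prod.snd))
  rw [← Finset.sum_product']
  exact Finset.sum_le_sum_of_subset_of_nonneg Finset.subset_product fun _ _ _ => by positivity

theorem summable_prod_mul_of_antidiagonal {c d w : ℕ → ℝ} (hc : ∀ j, 0 ≤ c j)
    (hd : ∀ j, 0 ≤ d j) (hw : ∀ n, ∑ j ∈ Finset.range (n + 1), c j = w n)
    (hs : Summable fun n => w n * d n) :
    Summable fun p : ℕ × ℕ => c p.1 * d (p.1 + p.2) := by
  rw [← (Finset.HasAntidiagonal.sigmaAntidiagonalEquivProd (A := ℕ)).summable_iff]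
  refine (summable_sigma_of_nonneg fun _ => mul_nonneg (hc _) (hd _)).2 ⟨fun n => (hasSum_fintype _).summable, ?_⟩
  convert hs using 2 with n
  rw [tsum_fintype, ← hw, Finset.sum_mul]
  simp only [Finset.HasAntidiagonal.sigmaAntidiagonalEquivProd_apply]
  rw [Finset.sum_coe_sort (Finset.HasAntidiagonal.antidiagonal n) fun p : ℕ × ℕ => c p.1 * d (p.1 + p.2),
    Finset.Nat.sum_antidiagonal_eq_sum_range_succ fun i j => c i * d (i + j)]
  refine Finset.sum_congr rfl fun k hk => ?_
  rw [Nat.add_sub_cancel' (Nat.lt_succ_iff.1 (Finset.mem_range.1 hk))]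

theorem stmt6 {X U Y : Type*}
    [NormedAddCommGroup X] [InnerProductSpace ℂ X] [CompleteSpace X]
    [NormedAddCommGroup U] [InnerProductSpace ℂ U] [CompleteSpace U]
    [NormedAddCommGroup Y] [InnerProductSpace ℂ Y] [CompleteSpace Y]
    (β : ℕ → ℝ) (hβ : IsWeightSeq β) (hmono : ∀ j, β (j + 1) ≤ β j)
    (c : ℕ → ℝ) (hc0 : c 0 = 1) (hcs : ∀ j, c (j + 1) = (β (j + 1))⁻¹ - (β j)⁻¹)
    (T : X →L[ℂ] X) (E : X →L[ℂ] Y) (hET : OutputStable β E T)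
    (F : ℂ → (U →L[ℂ] lp (fun _ : ℕ => Y) 2)) (hF : IsSchur F)
    -- `Fc j k` is the `k`-th Taylor coefficient of the `j`-th component of `F`
    (Fc : ℕ → ℕ → (U →L[ℂ] Y))
    (hFc : ∀ (j : ℕ), ∀ z ∈ ball (0 : ℂ) 1, ∀ u : U,
      HasSum (fun k => z ^ k • Fc j k u) ((F z u) j)) :
    -- with `S = Ψ_β F`, whose Taylor coefficients are `S_ℓ = Σ_{k≤ℓ} √(c_k) Fc k (ℓ-k)`,
    -- the series `Σ_ℓ ⟨S_ℓ u, E T^ℓ x⟩` and the iterated series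
    -- `Σ_k (Σ_j √(c_j) ⟨Fc j k u, E T^{j+k} x⟩)` both converge and agree
    ∀ (u : U) (x : X), ∃ (s : ℂ) (t : ℕ → ℂ),
      HasSum (fun ℓ => inner (𝕜 := ℂ) (E ((T ^ ℓ) x))
        (∑ k ∈ Finset.range (ℓ + 1), (Real.sqrt (c k) : ℂ) • Fc k (ℓ - k) u)) s ∧
      (∀ k, HasSum (fun j => (Real.sqrt (c j) : ℂ) *
        inner (𝕜 := ℂ) (E ((T ^ (j + k)) x)) (Fc j k u)) (t k)) ∧
      HasSum t s := by
  intro u x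
  have hc : ∀ j, 0 ≤ c j := by
    rintro (_ | j)
    · simp [hc0]
    · rw [hcs, sub_nonneg]
      exact inv_anti₀ (hβ.1 _) (hmono j)
  have hsumc : ∀ n, ∑ j ∈ Finset.range (n + 1), c j = (β n)⁻¹ := by
    intro n
    induction n with
    | zero => simp [hc0, hβ.2.1]
    | succ n ih => rw [Finset.sum_range_succ, ih, hcs]; ring
  have hA : Summable fun p : ℕ × ℕ => ‖Fc p.1 p.2 u‖ ^ 2 :=
    summable_norm_sq_coeff (G := fun z => F z u) (a := fun j k => Fc j k u) (M := ‖u‖)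
      (fun z hz => ((F z).le_of_opNorm_le (hF.2 z hz) u).trans_eq (one_mul _))
      fun j z hz => hFc j z hz u
  obtain ⟨C, -, hC⟩ := hET
  have hB := summable_prod_mul_of_antidiagonal hc (d := fun n => ‖E ((T ^ n) x)‖ ^ 2)
    (fun _ => by positivity) hsumc (hC x).1
  let f : ℕ × ℕ → ℂ := fun p => (Real.sqrt (c p.1) : ℂ) *
    inner (𝕜 := ℂ) (E ((T ^ (p.1 + p.2)) x)) (Fc p.1 p.2 u)
  have hf : Summable f := by
    refine (hA.add hB).of_norm_bounded fun p => ?_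
    have h1 : ‖f p‖ ≤ √(c p.1) * (‖E ((T ^ (p.1 + p.2)) x)‖ * ‖Fc p.1 p.2 u‖) := by
      rw [norm_mul, Complex.norm_real, Real.norm_of_nonneg (Real.sqrt_nonneg _)]
      exact mul_le_mul_of_nonneg_left (norm_inner_le_norm _ _) (Real.sqrt_nonneg _)
    have h2 := Real.sq_sqrt (hc p.1)
    refine h1.trans ?_
    nth_rewrite 2 [← h2]
    nlinarith [sq_nonneg (√(c p.1) * ‖E ((T ^ (p.1 + p.2)) x)‖ - ‖Fc p.1 p.2 u‖),
      sq_nonneg (√(c p.1) * ‖E ((T ^ (p.1 + p.2)) x)‖), sq_nonneg ‖Fc p.1 p.2 u‖]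
  have hswap : Summable fun p : ℕ × ℕ => f p.swap := (Equiv.prodComm ℕ ℕ).summable_iff.2 hf
  have hk : ∀ k, HasSum (fun j => f (j, k)) (∑' j, f (j, k)) := fun k =>
    (hswap.prod_factor k).hasSum
  refine ⟨∑' p, f p, fun k => ∑' j, f (j, k), ?_, hk, ?_⟩
  · have hσ := (Finset.HasAntidiagonal.sigmaAntidiagonalEquivProd (A := ℕ)).hasSum_iff.2 hf.hasSum
    convert hσ.sigma fun n => hasSum_fintype _ using 2 with n
    simp only [Function.comp_apply, Finset.HasAntidiagonal.sigmaAntidiagonalEquivProd_apply]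
    rw [Finset.sum_coe_sort (Finset.HasAntidiagonal.antidiagonal n) f,
      Finset.Nat.sum_antidiagonal_eq_sum_range_succ_mk, inner_sum]
    refine Finset.sum_congr rfl fun k hk => ?_
    simp only [f, inner_smul_right]
    rw [Nat.add_sub_cancel' (Nat.lt_succ_iff.1 (Finset.mem_range.1 hk))]
  · exact ((Equiv.prodComm ℕ ℕ).hasSum_iff.2 hf.hasSum).prod_fiberwise hk
end
end
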